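/- arXiv:1407.7569 — 2 statements merged into one kernel-verified Lean document; each statement's English description precedes it below -/
import Mathlib

section
/- Let a, b, N be real numbers, m_1, m_2, m_3, m_4 nonnegative integers with m = m_1+m_2+m_3+m_4 ≥ 1, and let Y_1,…,Y_m be arbitrary polynomials. Set θ_x = x(x+a+b+1) and σ_x = −(2x+a+b−1), and let ε_n^h be given by: ε_n^h = −(n−N−1)/(n+a+b+N+1) for h ∈ 𝕌_1, ε_n^h = (n−N−1)(n+b)/[(n+a)(n+a+b+N+1)] for h ∈ 𝕌_2, ε_n^h = 1 for h ∈ 𝕌_3, ε_n^h = −(n+b)/(n+a) for h ∈ 𝕌_4, with the associated ξ^h_{x,i}. Let Ω(x) = det( ξ^l_{x−j,m−j} Y_l(θ_{x−j}) )_{l,j=1}^m, let Ξ be any polynomial in x invariant under ℐ^{a+b−m−1}, and define the rational function S(x) = σ_{x−(m−1)/2} Ξ(x) (D^{1;m−1}_{x−1})^{m_2+m_4} (D^{2;m−1}_{x−1})^{m_1+m_2} / (p(x)q(x)), where p(x) = ∏_{i=1}^{m_2+m_4−1} N^{1;m_2+m_4−i}_{x−m_1−m_3−i} D^{1;m_2+m_4−i}_{x−1}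 · ∏_{i=1}^{m_1+m_2−1} N^{2;m_1+m_2−i}_{x−m_3−m_4−i} D^{2;m_1+m_2−i}_{x−1} and q(x) = (−1)^{m(m−1)/2} ∏_{p=1}^{m−1} ∏_{s=1}^{p} σ_{x−m+(s+p+1)/2}. For h = 1,…,m define M_h(x) = Σ_{j=1}^m (−1)^{h+j} ξ^h_{x,m−j} S(x+j) det( ξ^l_{x+j−r,m−r} Y_l(θ_{x+j−r}) )_{l≠h; r≠j}. Then: (i) S(x)Ω(x) is a polynomial in x; (ii) for each h = 1,…,m there exists a polynomial M̃_h with M_h(x) = σ_{x+1} M̃_h(θ_x); and (iii) there exist polynomials λ(x) and P_S such that λ(x) − λ(x−1) = S(x)Ω(x) and P_S(θ_x) = 2λ(x) + Σ_{h=1}^m Y_h(θ_x) M_h(x), as identities of rational functions in x. -/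
open Polynomial Finset

/-- Pochhammer symbol `(z)_k = z(z+1)⋯(z+k−1)` for real `z`. -/
noncomputable def pch (k : ℕ) (z : ℝ) : ℝ := (ascPochhammer ℝ k).eval z

/-- `N^{1;j}_x = (x−j+b+1)_j`. -/
noncomputable def NN1 (b : ℝ) (j : ℕ) (x : ℝ) : ℝ := pch j (x - (j : ℝ) + b + 1)

/-- `N^{2;j}_x = (x−j−N)_j`. -/
noncomputable def NN2 (NP : ℝ) (j : ℕ) (x : ℝ) : ℝ := pch j (x - (j : ℝ) - NP)

/-- `D^{1;j}_x = (−1)^j (x−j+a+1)_j`. -/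
noncomputable def DD1 (a : ℝ) (j : ℕ) (x : ℝ) : ℝ := (-1 : ℝ) ^ j * pch j (x - (j : ℝ) + a + 1)

/-- `D^{2;j}_x = (−1)^j (x−j+a+b+N+2)_j`. -/
noncomputable def DD2 (a b NP : ℝ) (j : ℕ) (x : ℝ) : ℝ :=
  (-1 : ℝ) ^ j * pch j (x - (j : ℝ) + a + b + NP + 2)

/-- The denominator polynomial `p(x)`. -/
noncomputable def pDen (a b NP : ℝ) (m1 m2 m3 m4 : ℕ) (x : ℝ) : ℝ :=
  (∏ i ∈ Finset.Icc 1 (m2 + m4 - 1),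
      NN1 b (m2 + m4 - i) (x - (m1 : ℝ) - (m3 : ℝ) - (i : ℝ)) * DD1 a (m2 + m4 - i) (x - 1))
    * ∏ i ∈ Finset.Icc 1 (m1 + m2 - 1),
        NN2 NP (m1 + m2 - i) (x - (m3 : ℝ) - (m4 : ℝ) - (i : ℝ)) *
          DD2 a b NP (m1 + m2 - i) (x - 1)

/-- The denominator `q(x) = (−1)^{m(m−1)/2} ∏_{p=1}^{m−1} ∏_{s=1}^p σ_{x−m+(s+p+1)/2}`,
with `σ_t = −(2t+a+b−1)`. -/
noncomputable def qDen (a b : ℝ) (m : ℕ) (x : ℝ) : ℝ :=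
  (-1 : ℝ) ^ (m * (m - 1) / 2) *
    ∏ p ∈ Finset.Icc 1 (m - 1), ∏ s ∈ Finset.Icc 1 p,
      -(2 * (x - (m : ℝ) + ((s : ℝ) + (p : ℝ) + 1) / 2) + a + b - 1)

/-- The sequences `ε^h` attached to the four blocks `𝕌_1,…,𝕌_4` for the Hahn case. -/
noncomputable def epsBlock (a b NP : ℝ) (m1 m2 m3 : ℕ) {m : ℕ} (h : Fin m) (t : ℝ) : ℝ :=
  if (h : ℕ) < m1 then -(t - NP - 1) / (t + a + b + NP + 1)
  else if (h : ℕ) < m1 + m2 then (t - NP - 1) * (t + b) / ((t + a) * (t + a + b + NP + 1))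
  else if (h : ℕ) < m1 + m2 + m3 then 1
  else -(t + b) / (t + a)

/-- The auxiliary functions `ξ^h_{x,i} = ∏_{j=0}^{i−1} ε^h_{x−j}` (for `i ≥ 0`). -/
noncomputable def xiBlock (a b NP : ℝ) (m1 m2 m3 : ℕ) {m : ℕ} (h : Fin m) (x : ℝ) (i : ℕ) : ℝ :=
  ∏ j ∈ Finset.range i, epsBlock a b NP m1 m2 m3 h (x - (j : ℝ))

/-- Determinant of the minor of an `m × m` matrix obtained by deleting row `h`
and column `j`. -/
noncomputable def minorDet : (m : ℕ) → Matrix (Fin m) (Fin m) ℝ → Fin m → Fin m → ℝ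
  | 0, _, h, _ => Fin.elim0 h
  | _ + 1, A, h, j => Matrix.det (A.submatrix h.succAbove j.succAbove)

/-- The involution `ℐ^c` on `ℝ[x]`: `ℐ^c(p)(x) = p(−(x+c+1))`. -/
noncomputable def Iinv (c : ℝ) (p : Polynomial ℝ) : Polynomial ℝ :=
  p.comp (-(Polynomial.X + Polynomial.C (c + 1)))

/-- The determinant is divisible by a power of `π` as soon as `π` divides all entries lying in
the rows `U` and outside the columns `T`. -/
theorem pow_dvd_det_of_rows {n A : Type*} [Fintype n] [DecidableEq n] [CommRing A]
    (B : Matrix n n A) (π : A) (U T : Finset n)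
    (h : ∀ l ∈ U, ∀ j ∉ T, π ∣ B l j) : π ^ (#U - #T) ∣ B.det := by
  rw [← Matrix.det_transpose, Matrix.det_apply]
  refine Finset.dvd_sum fun τ _ => ?_
  rw [Units.smul_def, zsmul_eq_mul]
  refine Dvd.dvd.mul_left ?_ _
  have hcard : #U - #T ≤ #(U.filter fun l => τ l ∉ T) := by
    have h1 : #(U.filter fun l => τ l ∈ T) ≤ #T :=
      Finset.card_le_card_of_injOn τ (fun l hl => (Finset.mem_filter.1 hl).2)
        τ.injective.injOn
    have h2 := Finset.card_filter_add_card_filter_not (s := U) (fun l => τ l ∈ T)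
    omega
  refine (pow_dvd_pow π hcard).trans ?_
  rw [← Finset.prod_const]
  exact (Finset.prod_dvd_prod_of_dvd _ (fun l => B l (τ l)) fun l hl =>
    h l (Finset.mem_filter.1 hl).1 _ (Finset.mem_filter.1 hl).2).trans
    (Finset.prod_dvd_prod_of_subset _ _ _ (Finset.subset_univ _))

/-- The determinant is divisible by `π ^ #I` when each column in `I` is congruent modulo `π`
to some column outside `I`. -/
theorem pow_dvd_det_of_cols {n A : Type*} [Fintype n] [DecidableEq n] [CommRing A]
    (π : A) (I : Finset n) (φ : n → n) (hφ : ∀ j ∈ I, φ j ∉ I) (B : Matrix n n A)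
    (h : ∀ j ∈ I, ∀ l, π ∣ B l j - B l (φ j)) : π ^ #I ∣ B.det := by
  induction I using Finset.induction_on generalizing B with
  | empty => simp
  | insert i I hi ih =>
    have hii : i ≠ φ i := fun hh => hφ i (mem_insert_self _ _) (hh ▸ mem_insert_self _ _)
    choose q hq using h i (mem_insert_self _ _)
    have hdet : B.det = π * (B.updateCol i q).det := by
      rw [← Matrix.det_updateCol_smul, ← Matrix.det_updateCol_add_smul_self _ hii (-1)]
      congr 2
      ext l
      simpa [sub_eq_add_neg] using hq l
    rw [hdet, card_insert_of_notMem hi, pow_succ']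
    refine mul_dvd_mul_left _ (ih (fun j hj hh => hφ j (mem_insert_of_mem hj)
      (mem_insert_of_mem hh)) _ fun j hj l => ?_)
    have h1 : j ≠ i := fun hh => hi (hh ▸ hj)
    have h2 : φ j ≠ i := fun hh => hφ j (mem_insert_of_mem hj) (hh ▸ mem_insert_self _ _)
    simpa [Matrix.updateCol_apply, h1, h2] using h j (mem_insert_of_mem hj) l

/-- The numerator attached to column `j` after clearing the denominators of `ξ`. -/
def colWeight {A : Type*} [CommRing A] (m : ℕ) (c α x : A) (j : ℕ) : A :=
  (∏ t ∈ range (m - 1 - j), (x - c + α + t)) * ∏ s ∈ range j, (α + s - x)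

/-- The value `θ_{x-j-1}` with `a + b = m - c`. -/
def colNode {A : Type*} [CommRing A] (m : ℕ) (c x : A) (j : ℕ) : A :=
  (x - j - 1) * (x - j + m - c)

theorem colWeight_reflect {A : Type*} [CommRing A] {m : ℕ} (c α x : A) {j : ℕ} (hj : j < m) :
    colWeight m c α (c - x) j = colWeight m c α x (m - 1 - j) := by
  have h : m - 1 - (m - 1 - j) = j := by omega
  rw [colWeight, colWeight, h, mul_comm]
  congr 1 <;> refine prod_congr rfl fun _ _ => by ring

theorem colNode_reflect {A : Type*} [CommRing A] {m : ℕ} (c x : A) {j : ℕ} (hj : j < m) :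
    colNode m c (c - x) j = colNode m c x (m - 1 - j) := by
  obtain ⟨k, rfl⟩ := Nat.exists_eq_add_of_lt hj
  have h : j + k + 1 - 1 - j = k := by omega
  rw [colNode, colNode, h]
  push_cast
  ring

theorem colWeight_eq_of_center {A : Type*} [CommRing A] {m : ℕ} (c α r : A) {i j : ℕ}
    (hij : i ≤ j) (hj : j < m) (hr : 2 * r = c - m + 1 + (i + j : ℕ)) :
    colWeight m c α r i = colWeight m c α r j := by
  obtain ⟨d, rfl⟩ := Nat.exists_eq_add_of_le hij
  obtain ⟨k, rfl⟩ := Nat.exists_eq_add_of_lt hj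
  have h1 : i + d + k + 1 - 1 - i = k + d := by omega
  have h2 : i + d + k + 1 - 1 - (i + d) = k := by omega
  rw [colWeight, colWeight, h1, h2, prod_range_add, prod_range_add, mul_assoc, mul_comm (∏ x ∈ range d, _)]
  congr 2
  refine prod_congr rfl fun s _ => ?_
  push_cast at hr ⊢
  linear_combination hr

theorem colNode_eq_of_center {A : Type*} [CommRing A] {m : ℕ} (c r : A) {i j : ℕ}
    (hr : 2 * r = c - m + 1 + (i + j : ℕ)) : colNode m c r i = colNode m c r j := by
  rw [colNode, colNode]
  push_cast at hr
  linear_combination ((j : A) - i) * hr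

/-- The matrix of `Ω` after clearing the denominators of `ξ`. -/
noncomputable def hahnMat {A : Type*} [CommRing A] [Algebra ℝ A] {m : ℕ} (U U' : Finset (Fin m))
    (Y : Fin m → ℝ[X]) (c α α' x : A) : Matrix (Fin m) (Fin m) A :=
  Matrix.of fun l j => (if l ∈ U then colWeight m c α x j else 1) *
    (if l ∈ U' then colWeight m c α' x j else 1) * aeval (colNode m c x j) (Y l)

section map
variable {A B : Type*} [CommRing A] [Algebra ℝ A] [CommRing B] [Algebra ℝ B] (φ : A →ₐ[ℝ] B)

theorem map_colWeight (m : ℕ) (c α x : A) (j : ℕ) :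
    φ (colWeight m c α x j) = colWeight m (φ c) (φ α) (φ x) j := by
  simp [colWeight, map_prod]

theorem map_colNode (m : ℕ) (c x : A) (j : ℕ) :
    φ (colNode m c x j) = colNode m (φ c) (φ x) j := by
  simp [colNode]

theorem map_hahnMat {m : ℕ} (U U' : Finset (Fin m)) (Y : Fin m → ℝ[X]) (c α α' x : A)
    (l j : Fin m) :
    φ (hahnMat U U' Y c α α' x l j) = hahnMat U U' Y (φ c) (φ α) (φ α') (φ x) l j := by
  simp only [hahnMat, Matrix.of_apply, map_mul, apply_ite φ, map_one, map_colWeight,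
    ← aeval_algHom_apply, map_colNode]

end map

/-- The number of pairs `(p, s)` with `1 ≤ s ≤ p ≤ m - 1` contributing the `t`-th root of `q`. -/
def pairCount (m t : ℕ) : ℕ :=
  #{z ∈ (Icc 1 (m - 1)).sigma fun p => Icc 1 p | 2 * m - 1 - z.2 - z.1 = t}

/-- The roots of `p q`, in five families. -/
noncomputable def rootVal (m : ℕ) (c α α' : ℝ) (f : Fin 5) (t : ℕ) : ℝ :=
  ![c - α, α, c - α', α', (c - m + 1) / 2] f + ![-1, 1, -1, 1, 1 / 2] f * t

/-- The multiplicities of the roots of `p q`. -/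
def rootExp (m k k' : ℕ) (f : Fin 5) (t : ℕ) : ℕ :=
  ![k - 1 - t, k - 1 - t, k' - 1 - t, k' - 1 - t, pairCount m t] f

section deform
variable {m : ℕ} (U U' : Finset (Fin m)) (Y : Fin m → ℝ[X]) (c α α' : ℝ)

/-- `hahnMat` with `α, α'` deformed to `α + T, α' + 3 T`, which separates the root families. -/
noncomputable def deformedMat : Matrix (Fin m) (Fin m) ℝ[X][X] :=
  hahnMat U U' Y (C (C c)) (C (C α + X)) (C (C α' + C 3 * X)) X

/-- The roots of the deformed `p q`. -/
noncomputable def deformedRoot (m : ℕ) (c α α' : ℝ) (f : Fin 5) (t : ℕ) : ℝ[X] :=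
  C (rootVal m c α α' f t) + C (![-1, 1, -3, 3, 0] f) * X

theorem deformedRoot_injective {f f' : Fin 5} {t t' : ℕ}
    (h : deformedRoot m c α α' f t = deformedRoot m c α α' f' t') : f = f' ∧ t = t' := by
  have h0 := congrArg (fun p => coeff p 0) h
  have h1 := congrArg (fun p => coeff p 1) h
  simp only [deformedRoot, coeff_add, coeff_C_mul, coeff_X_one, coeff_X_zero, coeff_C_zero,
    coeff_C_succ] at h0 h1
  have hf : f = f' := by
    fin_cases f <;> fin_cases f' <;> first | rfl | (exfalso; norm_num at h1)
  subst hf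
  refine ⟨rfl, ?_⟩
  have : (t : ℝ) = t' := by
    fin_cases f <;> simp [rootVal] at h0 <;> assumption_mod_cast
  exact_mod_cast this

theorem eval_deformedMat (r : ℝ[X]) (l j : Fin m) :
    eval r (deformedMat U U' Y c α α' l j) =
      hahnMat U U' Y (C c) (C α + X) (C α' + C 3 * X) r l j := by
  have := map_hahnMat ((aeval r : ℝ[X][X] →ₐ[ℝ[X]] ℝ[X]).restrictScalars ℝ) U U' Y
    (C (C c)) (C (C α + X)) (C (C α' + C 3 * X)) X l j
  simpa [coe_aeval_eq_eval, deformedMat] using this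

theorem dvd_deformedMat_of_colWeight (r : ℝ[X]) (l j : Fin m)
    (h : (l ∈ U ∧ colWeight m (C c) (C α + X) r j = 0) ∨
      (l ∈ U' ∧ colWeight m (C c) (C α' + C 3 * X) r j = 0)) :
    X - C r ∣ deformedMat U U' Y c α α' l j := by
  rw [dvd_iff_isRoot, IsRoot, eval_deformedMat, hahnMat, Matrix.of_apply]
  rcases h with ⟨h1, h2⟩ | ⟨h1, h2⟩ <;> simp [h1, h2]

theorem colWeight_left_root {A : Type*} [CommRing A] (c α : A) {t j : ℕ} (h : t < m - 1 - j) :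
    colWeight m c α (c - α - t) j = 0 := by
  rw [colWeight, prod_eq_zero (mem_range.2 h) (by ring), zero_mul]

theorem colWeight_right_root {A : Type*} [CommRing A] (c α : A) {s j : ℕ} (h : s < j) :
    colWeight m c α (α + s) j = 0 := by
  rw [colWeight, prod_eq_zero (mem_range.2 h) (by ring), mul_zero]

theorem card_filter_ge_le (t : ℕ) : #{j : Fin m | m - 1 ≤ t + j} ≤ t + 1 := by
  rw [← card_range (t + 1)]
  refine Finset.card_le_card_of_injOn (fun j => m - 1 - (j : ℕ)) (fun j hj => ?_)
    (fun i _ j _ h => Fin.ext ?_)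
  · have := (mem_filter.1 hj).2
    simp only [coe_range, Set.mem_Iio]
    omega
  · simp only at h
    omega

theorem card_filter_le_le (t : ℕ) : #{j : Fin m | (j : ℕ) ≤ t} ≤ t + 1 := by
  rw [← card_range (t + 1)]
  refine Finset.card_le_card_of_injOn (fun j => (j : ℕ)) (fun j hj => ?_)
    (fun i _ j _ h => Fin.ext h)
  have := (mem_filter.1 hj).2
  simp only [coe_range, Set.mem_Iio]
  omega

theorem pow_dvd_det_left (V : Finset (Fin m)) (B : Matrix (Fin m) (Fin m) ℝ[X][X]) (π : ℝ[X][X])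
    (t : ℕ) (h : ∀ l ∈ V, ∀ j : Fin m, t < m - 1 - j → π ∣ B l j) :
    π ^ (#V - 1 - t) ∣ B.det :=
  (pow_dvd_pow _ (by have := card_filter_ge_le (m := m) t; omega)).trans
    (pow_dvd_det_of_rows B π V {j : Fin m | m - 1 ≤ t + j} fun l hl j hj =>
      h l hl j (by simp at hj; omega))

theorem pow_dvd_det_right (V : Finset (Fin m)) (B : Matrix (Fin m) (Fin m) ℝ[X][X]) (π : ℝ[X][X])
    (t : ℕ) (h : ∀ l ∈ V, ∀ j : Fin m, t < (j : ℕ) → π ∣ B l j) :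
    π ^ (#V - 1 - t) ∣ B.det :=
  (pow_dvd_pow _ (by have := card_filter_le_le (m := m) t; omega)).trans
    (pow_dvd_det_of_rows B π V {j : Fin m | (j : ℕ) ≤ t} fun l hl j hj =>
      h l hl j (by simp at hj; omega))

theorem pairCount_le (t : ℕ) :
    pairCount m t ≤ #{j : Fin m | t < 2 * j ∧ (j : ℕ) ≤ t} := by
  rcases Nat.eq_zero_or_pos m with rfl | hm
  · simp [pairCount]
  refine Finset.card_le_card_of_injOn
    (fun z => if h : m - z.2 < m then ⟨m - z.2, h⟩ else ⟨0, hm⟩) ?_ ?_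
  · rintro ⟨p, s⟩ hz
    simp only [coe_filter, mem_sigma, mem_Icc, Set.mem_ofPred_eq] at hz
    have h : m - s < m := by omega
    simp only [h, dif_pos, coe_filter, mem_univ, true_and, Set.mem_ofPred_eq]
    omega
  · rintro ⟨p, s⟩ hz ⟨p', s'⟩ hz' he
    simp only [coe_filter, mem_sigma, mem_Icc, Set.mem_ofPred_eq] at hz hz'
    have h : m - s < m := by omega
    have h' : m - s' < m := by omega
    simp only [h, h', dif_pos, Fin.mk.injEq] at he
    obtain rfl : s = s' := by omega
    obtain rfl : p = p' := by omega
    rfl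

theorem pow_pairCount_dvd_det (t : ℕ) :
    (X - C (deformedRoot m c α α' 4 t)) ^ pairCount m t ∣ (deformedMat U U' Y c α α').det := by
  refine (pow_dvd_pow _ (pairCount_le t)).trans (pow_dvd_det_of_cols _ _
    (fun j => ⟨min (t - j) j, by omega⟩) ?_ _ ?_)
  · intro j hj
    simp only [mem_filter, mem_univ, true_and] at hj ⊢
    omega
  · intro j hj l
    simp only [mem_filter, mem_univ, true_and] at hj
    have hr : 2 * deformedRoot m c α α' 4 t = C c - m + 1 + ((t - j + j : ℕ) : ℝ[X]) := by
      rw [Nat.sub_add_cancel hj.2]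
      have h4 : deformedRoot m c α α' 4 t = C ((c - m + 1 + t) / 2) := by
        simp only [deformedRoot, rootVal, Matrix.cons_val, C_0, zero_mul, add_zero]
        congr 1
        ring
      rw [h4, show (2 : ℝ[X]) = C 2 from rfl, ← C_mul, mul_div_cancel₀ _ two_ne_zero]
      simp
    have hmin : min (t - (j : ℕ)) j = t - j := by omega
    rw [dvd_iff_isRoot, IsRoot, eval_sub, eval_deformedMat, eval_deformedMat, sub_eq_zero]
    simp only [hahnMat, Matrix.of_apply, hmin]
    rw [colWeight_eq_of_center _ _ _ (by omega) j.2 hr, colWeight_eq_of_center _ _ _ (by omega) j.2 hr,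
      colNode_eq_of_center _ _ hr]

theorem root_pow_dvd_det (f : Fin 5) (t : ℕ) :
    (X - C (deformedRoot m c α α' f t)) ^ rootExp m #U #U' f t ∣
      (deformedMat U U' Y c α α').det := by
  have e0 : deformedRoot m c α α' 0 t = C c - (C α + X) - (t : ℝ[X]) := by
    simp [deformedRoot, rootVal]; ring
  have e1 : deformedRoot m c α α' 1 t = (C α + X) + (t : ℝ[X]) := by
    simp [deformedRoot, rootVal]; ring
  have e2 : deformedRoot m c α α' 2 t = C c - (C α' + C 3 * X) - (t : ℝ[X]) := by
    simp [deformedRoot, rootVal]; ring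
  have e3 : deformedRoot m c α α' 3 t = (C α' + C 3 * X) + (t : ℝ[X]) := by
    simp [deformedRoot, rootVal]; ring
  have h0 : (X - C (deformedRoot m c α α' 0 t)) ^ (#U - 1 - t) ∣
      (deformedMat U U' Y c α α').det := by
    refine pow_dvd_det_left U _ _ t fun l hl j hj => dvd_deformedMat_of_colWeight _ _ _ _ _ _ _ _ _
      (Or.inl ⟨hl, ?_⟩)
    rw [e0]
    exact colWeight_left_root _ _ hj
  have h1 : (X - C (deformedRoot m c α α' 1 t)) ^ (#U - 1 - t) ∣
      (deformedMat U U' Y c α α').det := by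
    refine pow_dvd_det_right U _ _ t fun l hl j hj => dvd_deformedMat_of_colWeight _ _ _ _ _ _ _ _ _
      (Or.inl ⟨hl, ?_⟩)
    rw [e1]
    exact colWeight_right_root _ _ hj
  have h2 : (X - C (deformedRoot m c α α' 2 t)) ^ (#U' - 1 - t) ∣
      (deformedMat U U' Y c α α').det := by
    refine pow_dvd_det_left U' _ _ t fun l hl j hj => dvd_deformedMat_of_colWeight _ _ _ _ _ _ _ _ _
      (Or.inr ⟨hl, ?_⟩)
    rw [e2]
    exact colWeight_left_root _ _ hj
  have h3 : (X - C (deformedRoot m c α α' 3 t)) ^ (#U' - 1 - t) ∣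
      (deformedMat U U' Y c α α').det := by
    refine pow_dvd_det_right U' _ _ t fun l hl j hj => dvd_deformedMat_of_colWeight _ _ _ _ _ _ _ _ _
      (Or.inr ⟨hl, ?_⟩)
    rw [e3]
    exact colWeight_right_root _ _ hj
  fin_cases f
  exacts [h0, h1, h2, h3, pow_pairCount_dvd_det U U' Y c α α' t]

theorem prod_root_dvd_det :
    (∏ f : Fin 5, ∏ t ∈ range (2 * m),
      (X - C (deformedRoot m c α α' f t)) ^ rootExp m #U #U' f t) ∣
      (deformedMat U U' Y c α α').det := by
  rw [← prod_product' (s := univ) (t := range (2 * m)) (f := fun f t =>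
      (X - C (deformedRoot m c α α' f t)) ^ rootExp m #U #U' f t)]
  refine Finset.prod_dvd_of_isRelPrime ?_ fun z _ => root_pow_dvd_det U U' Y c α α' z.1 z.2
  rintro ⟨f, t⟩ - ⟨f', t'⟩ - hne
  refine IsRelPrime.pow (((irreducible_X_sub_C _).isRelPrime_iff_not_dvd).2 fun hd => hne ?_)
  rw [dvd_iff_isRoot] at hd
  simp only [IsRoot, eval_sub, eval_X, eval_C, sub_eq_zero] at hd
  obtain ⟨rfl, rfl⟩ := deformedRoot_injective c α α' hd
  rfl

end deform

/-- The cleared determinant is divisible by `p q`, for all values of the parameters. -/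
theorem exists_det_hahnMat_eq {m : ℕ} (U U' : Finset (Fin m)) (Y : Fin m → ℝ[X]) (c α α' : ℝ) :
    ∃ V : ℝ[X], ∀ x : ℝ, (hahnMat U U' Y c α α' x).det =
      (∏ f : Fin 5, ∏ t ∈ range (2 * m),
        (x - rootVal m c α α' f t) ^ rootExp m #U #U' f t) * V.eval x := by
  obtain ⟨V, hV⟩ := prod_root_dvd_det U U' Y c α α'
  refine ⟨V.map (evalRingHom 0), fun x => ?_⟩
  have h := congrArg ((aeval x : ℝ[X] →ₐ[ℝ] ℝ).comp (mapAlgHom (aeval (0 : ℝ)))) hV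
  rw [AlgHom.map_det, map_mul, map_prod] at h
  have hmat : ((aeval x : ℝ[X] →ₐ[ℝ] ℝ).comp (mapAlgHom (aeval (0 : ℝ)))).mapMatrix
      (deformedMat U U' Y c α α') = hahnMat U U' Y c α α' x := by
    ext l j
    rw [AlgHom.mapMatrix_apply, Matrix.map_apply, deformedMat, map_hahnMat]
    simp
  rw [hmat] at h
  rw [h]
  congr 1
  simp [map_prod, deformedRoot]

theorem pch_eq_prod (k : ℕ) (z : ℝ) : pch k z = ∏ t ∈ range k, (z + t) := by
  induction k with
  | zero => simp [pch]
  | succ k ih => rw [pch, ascPochhammer_succ_eval, prod_range_succ, ← ih, pch]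

theorem neg_one_pow_mul_pch (k : ℕ) (α y : ℝ) :
    (-1) ^ k * pch k (y - k + 1 - α) = ∏ s ∈ range k, (α + s - y) := by
  rw [pch_eq_prod, ← prod_range_reflect, ← card_range k, ← prod_const, card_range,
    ← prod_mul_distrib]
  refine prod_congr rfl fun s hs => ?_
  have hs := mem_range.1 hs
  rw [Nat.cast_sub (by omega), Nat.cast_sub (by omega)]
  push_cast
  ring

theorem DD1_eq_prod (a : ℝ) (k : ℕ) (y : ℝ) :
    DD1 a k (y - 1) = ∏ s ∈ range k, ((1 - a) + s - y) := by
  rw [← neg_one_pow_mul_pch, DD1]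
  ring_nf

theorem DD2_eq_prod (a b N : ℝ) (k : ℕ) (y : ℝ) :
    DD2 a b N k (y - 1) = ∏ s ∈ range k, ((-a - b - N) + s - y) := by
  rw [← neg_one_pow_mul_pch, DD2]
  ring_nf

theorem prod_triangle {A : Type*} [CommMonoid A] {k M : ℕ} (hk : k ≤ M) (f : ℕ → A) :
    ∏ i ∈ Icc 1 (k - 1), ∏ t ∈ range (k - i), f t = ∏ t ∈ range M, f t ^ (k - 1 - t) := by
  rw [prod_comm' (t' := range M) (s' := fun t => Icc 1 (k - 1 - t))]
  · simp
  · intro i t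
    simp only [mem_Icc, mem_range]
    omega

/-- One of the two halves of `p`. -/
def halfDen (m k : ℕ) (c α x : ℝ) : ℝ :=
  ∏ t ∈ range (2 * m), ((x - c + α + t) * (α + t - x)) ^ (k - 1 - t)

theorem halfDen_reflect (m k : ℕ) (c α x : ℝ) : halfDen m k c α (c - x) = halfDen m k c α x := by
  refine prod_congr rfl fun t _ => ?_
  ring_nf

theorem pDen_eq {a b N : ℝ} {m1 m2 m3 m4 m : ℕ} (hm : m = m1 + m2 + m3 + m4) (x : ℝ) :
    pDen a b N m1 m2 m3 m4 x = halfDen m (m2 + m4) (m - a - b) (1 - a) x *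
      halfDen m (m1 + m2) (m - a - b) (-a - b - N) x := by
  rw [pDen, halfDen, halfDen, ← prod_triangle (by omega), ← prod_triangle (by omega)]
  congr 1
  · refine prod_congr rfl fun i hi => ?_
    have hi := mem_Icc.1 hi
    rw [DD1_eq_prod, NN1, pch_eq_prod, ← prod_mul_distrib]
    refine prod_congr rfl fun t _ => ?_
    rw [Nat.cast_sub (by omega), hm]
    push_cast
    ring
  · refine prod_congr rfl fun i hi => ?_
    have hi := mem_Icc.1 hi
    rw [DD2_eq_prod, NN2, pch_eq_prod, ← prod_mul_distrib]
    refine prod_congr rfl fun t _ => ?_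
    rw [Nat.cast_sub (by omega), hm]
    push_cast
    ring

theorem sign_revPerm (m : ℕ) :
    ((Equiv.Perm.sign (Fin.revPerm (n := m)) : ℤ) : ℝ) = (-1) ^ ∑ i ∈ range m, i := by
  rw [Equiv.Perm.sign_eq_prod_prod_Ioi]
  have h : ∀ i : Fin m, (∏ j ∈ Ioi i,
      if Fin.revPerm i < Fin.revPerm j then (1 : ℤˣ) else -1) = (-1) ^ (m - 1 - (i : ℕ)) := by
    intro i
    rw [prod_congr rfl (g := fun _ => -1), prod_const, Fin.card_Ioi]
    intro j hj
    have := mem_Ioi.1 hj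
    rw [if_neg]
    simpa using this.le
  simp_rw [h]
  rw [Fin.prod_univ_eq_prod_range (fun i => (-1 : ℤˣ) ^ (m - 1 - i)) m,
    prod_range_reflect (fun i => (-1 : ℤˣ) ^ i) m, prod_pow_eq_pow_sum]
  simp

theorem qDen_reflect (a b : ℝ) (m : ℕ) (x : ℝ) :
    qDen a b m (m - a - b - x) =
      ((Equiv.Perm.sign (Fin.revPerm (n := m)) : ℤ) : ℝ) * qDen a b m x := by
  have hsum : ∑ i ∈ range m, i = #((Icc 1 (m - 1)).sigma fun p => Icc 1 p) := by
    rw [card_sigma]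
    simp only [Nat.card_Icc, Nat.add_sub_cancel]
    refine (sum_subset (fun i hi => ?_) fun i hi hi' => ?_).symm
    · simp only [mem_Icc, mem_range] at hi ⊢
      omega
    · simp only [mem_Icc, mem_range] at hi hi'
      omega
  rw [sign_revPerm, hsum, ← prod_const, qDen, qDen, mul_left_comm]
  congr 1
  rw [prod_sigma', prod_sigma', ← prod_mul_distrib]
  refine prod_nbij' (fun z => ⟨m - z.2, m - z.1⟩) (fun z => ⟨m - z.2, m - z.1⟩) ?_ ?_ ?_ ?_ ?_
  · rintro ⟨p, s⟩ h
    simp only [mem_sigma, mem_Icc] at h ⊢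
    omega
  · rintro ⟨p, s⟩ h
    simp only [mem_sigma, mem_Icc] at h ⊢
    omega
  · rintro ⟨p, s⟩ h
    simp only [mem_sigma, mem_Icc] at h
    rw [show m - (m - p) = p by omega, show m - (m - s) = s by omega]
  · rintro ⟨p, s⟩ h
    simp only [mem_sigma, mem_Icc] at h
    rw [show m - (m - p) = p by omega, show m - (m - s) = s by omega]
  · rintro ⟨p, s⟩ h
    simp only [mem_sigma, mem_Icc] at h
    rw [Nat.cast_sub (show s ≤ m by omega), Nat.cast_sub (show p ≤ m by omega)]
    ring

theorem qDen_eq (a b : ℝ) (m : ℕ) (α α' : ℝ) : ∃ u : ℝ, u ≠ 0 ∧ ∀ x, qDen a b m x =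
    u * ∏ t ∈ range (2 * m), (x - rootVal m (m - a - b) α α' 4 t) ^ pairCount m t := by
  refine ⟨(-1) ^ (m * (m - 1) / 2) * ∏ t ∈ range (2 * m), (-2) ^ pairCount m t,
    mul_ne_zero (by simp) (prod_ne_zero_iff.2 fun _ _ => by simp), fun x => ?_⟩
  rw [qDen, mul_assoc, ← prod_mul_distrib, prod_sigma',
    ← prod_fiberwise_of_maps_to (t := range (2 * m)) (g := fun z => 2 * m - 1 - z.2 - z.1)]
  · congr 1
    refine prod_congr rfl fun t _ => ?_
    rw [← mul_pow, pairCount, ← prod_const]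
    refine prod_congr rfl fun z hz => ?_
    simp only [mem_filter, mem_sigma, mem_Icc] at hz
    have : (z.1 : ℝ) + z.2 + t + 1 = 2 * m := by
      norm_cast
      omega
    simp only [rootVal, Matrix.cons_val]
    linear_combination -this
  · rintro ⟨p, s⟩ h
    simp only [mem_sigma, mem_Icc, mem_range] at h ⊢
    omega

theorem halfDen_eq (m k : ℕ) (c α : ℝ) : ∃ u : ℝ, u ≠ 0 ∧ ∀ x, halfDen m k c α x =
    u * ((∏ t ∈ range (2 * m), (x - (c - α + -1 * t)) ^ (k - 1 - t)) *
      ∏ t ∈ range (2 * m), (x - (α + 1 * t)) ^ (k - 1 - t)) := by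
  refine ⟨∏ t ∈ range (2 * m), (-1) ^ (k - 1 - t), prod_ne_zero_iff.2 fun _ _ => by simp,
    fun x => ?_⟩
  rw [halfDen, ← prod_mul_distrib, ← prod_mul_distrib]
  refine prod_congr rfl fun t _ => ?_
  rw [← mul_pow, ← mul_pow]
  ring_nf

theorem pDen_mul_qDen_eq {a b N : ℝ} {m1 m2 m3 m4 m : ℕ} (hm : m = m1 + m2 + m3 + m4) :
    ∃ u : ℝ, u ≠ 0 ∧ ∀ x, pDen a b N m1 m2 m3 m4 x * qDen a b m x =
      u * ∏ f : Fin 5, ∏ t ∈ range (2 * m),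
        (x - rootVal m (m - a - b) (1 - a) (-a - b - N) f t) ^
          rootExp m (m2 + m4) (m1 + m2) f t := by
  obtain ⟨u, hu, h⟩ := qDen_eq a b m (1 - a) (-a - b - N)
  obtain ⟨v, hv, h'⟩ := halfDen_eq m (m2 + m4) (m - a - b) (1 - a)
  obtain ⟨w, hw, h''⟩ := halfDen_eq m (m1 + m2) (m - a - b) (-a - b - N)
  refine ⟨u * v * w, by positivity, fun x => ?_⟩
  rw [pDen_eq hm, h, h', h'', Fin.prod_univ_five]
  simp only [rootVal, rootExp, Matrix.cons_val]
  ring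

/-- The rows carrying the factor `-(n + b) / (n + a)`. -/
def rowsA (m m1 m2 m3 : ℕ) : Finset (Fin m) :=
  {l | (m1 ≤ l ∧ (l : ℕ) < m1 + m2) ∨ m1 + m2 + m3 ≤ l}

/-- The rows carrying the factor `-(n - N - 1) / (n + a + b + N + 1)`. -/
def rowsB (m m1 m2 : ℕ) : Finset (Fin m) := {l | (l : ℕ) < m1 + m2}

theorem card_rowsA {m1 m2 m3 m4 m : ℕ} (hm : m = m1 + m2 + m3 + m4) :
    #(rowsA m m1 m2 m3) = m2 + m4 := by
  have h : (rowsA m m1 m2 m3).map Fin.valEmbedding =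
      Ico m1 (m1 + m2) ∪ Ico (m1 + m2 + m3) m := by
    ext i
    simp only [rowsA, mem_map, mem_filter, mem_univ, true_and, Fin.valEmbedding_apply, mem_union,
      mem_Ico]
    refine ⟨?_, fun hi => ⟨⟨i, by omega⟩, by dsimp only; omega, rfl⟩⟩
    rintro ⟨l, hl, rfl⟩
    omega
  rw [← card_map, h, card_union_of_disjoint, Nat.card_Ico, Nat.card_Ico]
  · omega
  · rw [disjoint_left]
    intro i
    simp only [mem_Ico]
    omega

theorem card_rowsB {m1 m2 m3 m4 m : ℕ} (hm : m = m1 + m2 + m3 + m4) :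
    #(rowsB m m1 m2) = m1 + m2 := by
  have h : (rowsB m m1 m2).map Fin.valEmbedding = range (m1 + m2) := by
    ext i
    simp only [rowsB, mem_map, mem_filter, mem_univ, true_and, Fin.valEmbedding_apply, mem_range]
    refine ⟨?_, fun hi => ⟨⟨i, by omega⟩, by omega, rfl⟩⟩
    rintro ⟨l, hl, rfl⟩
    omega
  rw [← card_map, h, card_range]

theorem epsBlock_eq (a b N : ℝ) (m1 m2 m3 : ℕ) {m : ℕ} (l : Fin m) (t : ℝ) :
    epsBlock a b N m1 m2 m3 l t =
      (if l ∈ rowsA m m1 m2 m3 then -(t + b) / (t + a) else 1) *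
        (if l ∈ rowsB m m1 m2 then -(t - N - 1) / (t + a + b + N + 1) else 1) := by
  simp only [epsBlock, rowsA, rowsB, mem_filter, mem_univ, true_and]
  split_ifs <;> first | omega | simp
  rw [div_mul_div_comm]
  ring

theorem prod_mul_prod_eq_colWeight {m j : ℕ} (hj : j < m) {c α y : ℝ}
    (hy : ∏ s ∈ range (m - 1), (α + s - y) ≠ 0) :
    (∏ s ∈ range (m - 1), (α + s - y)) * ∏ i ∈ range (m - j - 1),
        (-(y - j - 1 - i + m - 1 - c + α) / (y - j - 1 - i + 1 - α)) =
      colWeight m c α y j := by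
  obtain ⟨k, rfl⟩ := Nat.exists_eq_add_of_lt hj
  have h1 : j + k + 1 - 1 = j + k := by omega
  have h2 : j + k + 1 - j - 1 = k := by omega
  have h3 : j + k - j = k := by omega
  rw [h1, prod_range_add] at hy
  rw [colWeight, h1, h2, h3, prod_range_add, mul_comm (∏ x ∈ range k, _), mul_assoc,
    ← prod_mul_distrib, ← prod_range_reflect (fun t : ℕ => y - c + α + t)]
  congr 1
  have hne := prod_ne_zero_iff.1 (mul_ne_zero_iff.1 hy).2
  refine prod_congr rfl fun i hi => ?_
  have hi' := mem_range.1 hi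
  have hd : y - j - 1 - i + 1 - α ≠ 0 := fun hh => hne i hi (by push_cast; linarith)
  rw [Nat.cast_sub (by omega), Nat.cast_sub (by omega)]
  field_simp
  push_cast
  ring

theorem scale_mul_xiBlock {a b N y : ℝ} {m1 m2 m3 m : ℕ}
    (h1 : DD1 a (m - 1) (y - 1) ≠ 0) (h2 : DD2 a b N (m - 1) (y - 1) ≠ 0) (l j : Fin m) :
    (if l ∈ rowsA m m1 m2 m3 then DD1 a (m - 1) (y - 1) else 1) *
        (if l ∈ rowsB m m1 m2 then DD2 a b N (m - 1) (y - 1) else 1) *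
        xiBlock a b N m1 m2 m3 l (y - j - 1) (m - j - 1) =
      (if l ∈ rowsA m m1 m2 m3 then colWeight m (m - a - b) (1 - a) y j else 1) *
        (if l ∈ rowsB m m1 m2 then colWeight m (m - a - b) (-a - b - N) y j else 1) := by
  rw [DD1_eq_prod] at h1 ⊢
  rw [DD2_eq_prod] at h2 ⊢
  simp only [xiBlock, epsBlock_eq, prod_mul_distrib]
  rw [← prod_mul_prod_eq_colWeight j.2 h1, ← prod_mul_prod_eq_colWeight j.2 h2,
    mul_mul_mul_comm]
  congr 1
  · split_ifs
    · congr 1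
      refine prod_congr rfl fun i _ => ?_
      ring_nf
    · simp
  · split_ifs
    · congr 1
      refine prod_congr rfl fun i _ => ?_
      ring_nf
    · simp

/-- The weights multiplying the values `Y_l(θ_{x-j-1})` after clearing denominators. -/
noncomputable def hahnWeight (a b N : ℝ) (m1 m2 m3 : ℕ) {m : ℕ} (l j : Fin m) (x : ℝ) : ℝ :=
  (if l ∈ rowsA m m1 m2 m3 then colWeight m (m - a - b) (1 - a) x j else 1) *
    (if l ∈ rowsB m m1 m2 then colWeight m (m - a - b) (-a - b - N) x j else 1)

theorem hahnWeight_reflect (a b N : ℝ) (m1 m2 m3 : ℕ) {m : ℕ} (l j : Fin m) (x : ℝ) :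
    hahnWeight a b N m1 m2 m3 l j (m - a - b - x) = hahnWeight a b N m1 m2 m3 l j.rev x := by
  have h : ((j.rev : Fin m) : ℕ) = m - 1 - j := by rw [Fin.val_rev]; omega
  rw [hahnWeight, hahnWeight, colWeight_reflect _ _ _ j.2, colWeight_reflect _ _ _ j.2, h]

theorem scale_mul_det_xiBlock {a b N y : ℝ} {m1 m2 m3 m4 m : ℕ} (hm : m = m1 + m2 + m3 + m4)
    (h1 : DD1 a (m - 1) (y - 1) ≠ 0) (h2 : DD2 a b N (m - 1) (y - 1) ≠ 0)
    (f : Fin m → Fin m → ℝ) :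
    DD1 a (m - 1) (y - 1) ^ (m2 + m4) * DD2 a b N (m - 1) (y - 1) ^ (m1 + m2) *
        (Matrix.of fun l j : Fin m =>
          xiBlock a b N m1 m2 m3 l (y - j - 1) (m - j - 1) * f l j).det =
      (Matrix.of fun l j : Fin m => hahnWeight a b N m1 m2 m3 l j y * f l j).det := by
  rw [← card_rowsA hm, ← card_rowsB hm]
  simp only [hahnWeight, ← scale_mul_xiBlock h1 h2]
  have := Matrix.det_mul_column (fun l : Fin m =>
    (if l ∈ rowsA m m1 m2 m3 then DD1 a (m - 1) (y - 1) else 1) *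
        (if l ∈ rowsB m m1 m2 then DD2 a b N (m - 1) (y - 1) else 1))
    (Matrix.of fun l j : Fin m =>
          xiBlock a b N m1 m2 m3 l (y - j - 1) (m - j - 1) * f l j)
  simp only [Matrix.of_apply, ← mul_assoc] at this ⊢
  rw [this, prod_mul_distrib, prod_ite_mem, prod_ite_mem]
  simp

section Cofinite

open Filter

/-- The polynomial `θ_{x-j-1}` in `x`. -/
noncomputable def nodePoly (m : ℕ) (c : ℝ) (j : ℕ) : ℝ[X] := colNode m (C c) X j

theorem eval_nodePoly (m : ℕ) (c : ℝ) (j : ℕ) (y : ℝ) :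
    (nodePoly m c j).eval y = colNode m c y j := by
  simp [nodePoly, colNode]

theorem prod_erase_sub_eq_sum {m : ℕ} (v : Fin m → ℝ) (j : Fin m) (w : ℝ) :
    ∏ i ∈ univ.erase j, (w - v i) = ∑ n ∈ range m, ∑ i ∈ Icc (n + 1) m,
      v j ^ (i - (n + 1)) * (∏ i, (X - C (v i))).coeff i * w ^ n := by
  have hdiv : (∏ i, (X - C (v i))) /ₘ (X - C (v j)) = ∏ i ∈ univ.erase j, (X - C (v i)) := by
    rw [← mul_prod_erase univ _ (mem_univ j)]
    exact mul_divByMonic_cancel_left _ (monic_X_sub_C _)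
  have hdeg : (∏ i, (X - C (v i))).natDegree = m := by simp
  have hdeg' : (∏ i ∈ univ.erase j, (X - C (v i))).natDegree < m := by
    simp [card_erase_of_mem]
    exact j.pos
  calc ∏ i ∈ univ.erase j, (w - v i) = (∏ i ∈ univ.erase j, (X - C (v i))).eval w := by
        simp [eval_prod]
    _ = _ := by
        rw [eval_eq_sum_range' hdeg']
        refine sum_congr rfl fun n _ => ?_
        rw [← hdiv, coeff_divByMonic_X_sub_C, hdeg, sum_mul]

theorem exists_bivariate {m : ℕ} (c : ℝ) (K : Fin m → ℝ → ℝ)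
    (hK : ∀ g : ℝ[X], ∃ W : ℝ[X], ∀ᶠ y in (cofinite : Filter ℝ),
      ∑ j, K j y * g.eval (colNode m c y j) = W.eval y) :
    ∃ P : ℝ[X][X], ∀ᶠ y in (cofinite : Filter ℝ), ∀ w,
      (P.map (evalRingHom w)).eval y =
        ∑ j, K j y * ∏ i ∈ univ.erase j, (w - colNode m c y i) := by
  choose W hW using fun k : ℕ => hK (X ^ k)
  let Q : ℝ[X][X] := ∏ i : Fin m, (X - C (nodePoly m c i))
  refine ⟨∑ n ∈ range m, ∑ i ∈ Icc (n + 1) m,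
    (Q.coeff i * W (i - (n + 1))).map C * C (X ^ n), ?_⟩
  filter_upwards [(eventually_all_finset (range m)).2 fun k _ => hW k] with y hy w
  have hQ : ∀ i, (Q.coeff i).eval y = (∏ i : Fin m, (X - C (colNode m c y i))).coeff i := by
    intro i
    rw [← coe_evalRingHom, ← coeff_map, Polynomial.map_prod]
    simp [eval_nodePoly]
  have hcomp : (evalRingHom w).comp C = RingHom.id ℝ := by
    ext
    simp
  simp only [Polynomial.map_sum, eval_finsetSum, Polynomial.map_mul, Polynomial.map_map, hcomp,
    Polynomial.map_id, map_C, eval_mul, eval_C, hQ, coe_evalRingHom, eval_pow, eval_X,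
    prod_erase_sub_eq_sum, mul_sum]
  rw [sum_comm]
  refine sum_congr rfl fun n hn => ?_
  rw [sum_comm]
  refine sum_congr rfl fun i hi => ?_
  rw [← hy (i - (n + 1)) (by simp only [mem_range, mem_Icc] at *; omega), mul_sum, sum_mul]
  refine sum_congr rfl fun j _ => ?_
  rw [eval_pow, eval_X]
  ring

theorem erase_inl_eq_disjSum {m : ℕ} (k : Fin m) :
    (univ : Finset (Fin m ⊕ Fin m)).erase (Sum.inl k) = (univ.erase k).disjSum univ := by
  ext (i | i) <;> simp

theorem erase_inr_eq_disjSum {m : ℕ} (k : Fin m) :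
    (univ : Finset (Fin m ⊕ Fin m)).erase (Sum.inr k) = univ.disjSum (univ.erase k) := by
  ext (i | i) <;> simp

theorem summand_at_node {m : ℕ} (c : ℝ) (K : Fin m → ℝ → ℝ) {x x' : ℝ} (hx : x + x' = c - m - 1)
    (hgen : ∀ n ∈ Icc (-m : ℤ) m, x - x' ≠ n) (k : Fin m) :
    (∑ j, K j (x + k + 1) * ∏ i ∈ univ.erase j, (x * (x + m - c + 1) - colNode m c (x + k + 1) i)) /
      ((∏ j ∈ univ.erase k, (x + k + 1 - (x + (j : ℕ) + 1))) *
        ∏ j : Fin m, (x + k + 1 - (x' + (j : ℕ) + 1))) =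
    (-1) ^ (m - 1) * K k (x + k + 1) / (x - x') := by
  have hfac : ∀ i : Fin m, x * (x + m - c + 1) - colNode m c (x + k + 1) i =
      -1 * ((x + k + 1 - (x + (i : ℕ) + 1)) * (x + k + 1 - (x' + (i : ℕ) + 1))) := by
    intro i
    rw [colNode]
    linear_combination (i - k : ℝ) * hx
  have h1 : ∏ j ∈ univ.erase k, (x + k + 1 - (x + (j : ℕ) + 1)) ≠ 0 := by
    refine prod_ne_zero_iff.2 fun j hj h => (mem_erase.1 hj).1 (Fin.ext ?_)
    have : (j : ℝ) = k := by linarith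
    exact_mod_cast this
  have h2 : ∏ j ∈ univ.erase k, (x + k + 1 - (x' + (j : ℕ) + 1)) ≠ 0 := by
    refine prod_ne_zero_iff.2 fun j hj h => hgen ((j : ℤ) - k) ?_ ?_
    · rw [mem_Icc]
      omega
    · push_cast
      linarith
  have h3 : x - x' ≠ 0 := by simpa using hgen 0 (by simp)
  rw [sum_eq_single k, ← mul_prod_erase univ (fun j : Fin m => (x + k + 1 - (x' + (j : ℕ) + 1)))
    (mem_univ k), prod_congr rfl fun i _ => hfac i, prod_mul_distrib, prod_mul_distrib, prod_const,
    card_erase_of_mem (mem_univ k), card_univ, Fintype.card_fin,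
    show x + k + 1 - (x' + (k : ℕ) + 1) = x - x' by ring]
  · field_simp
  · intro j _ hj
    rw [prod_eq_zero (mem_erase.2 ⟨hj.symm, mem_univ k⟩), mul_zero]
    rw [hfac]
    ring
  · simp

theorem eventually_comp_affine {p : ℝ → Prop} (h : ∀ᶠ y in (cofinite : Filter ℝ), p y) (r : ℝ) :
    ∀ᶠ x in (cofinite : Filter ℝ), p (x + r) :=
  (add_left_injective r).tendsto_cofinite.eventually h

theorem eventually_comp_reflect {p : ℝ → Prop} (h : ∀ᶠ y in (cofinite : Filter ℝ), p y) (r : ℝ) :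
    ∀ᶠ x in (cofinite : Filter ℝ), p (r - x) :=
  (sub_right_injective (b := r)).tendsto_cofinite.eventually h

theorem exists_sum_shift_eq {m : ℕ} (c : ℝ) (K : Fin m → ℝ → ℝ)
    (hK : ∀ g : ℝ[X], ∃ W : ℝ[X], ∀ᶠ y in (cofinite : Filter ℝ),
      ∑ j, K j y * g.eval (colNode m c y j) = W.eval y)
    (hanti : ∀ j, ∀ᶠ y in (cofinite : Filter ℝ), K j.rev (c - y) = -K j y) :
    ∃ R : ℝ[X], ∀ᶠ x in (cofinite : Filter ℝ),
      ∑ j, K j (x + j + 1) = -(2 * x + m - c + 1) * R.eval (x * (x + m - c + 1)) := by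
  obtain ⟨P, hP⟩ := exists_bivariate c K hK
  let D : ℝ[X][X] := ∏ j : Fin m, ((nodePoly m c j).map C - C X)
  let v : ℝ → Fin m ⊕ Fin m → ℝ :=
    fun x => Sum.elim (fun j => x + j + 1) fun j => (c - m - 1 - x) + j + 1
  have hfac : ∀ (x : ℝ) (j : Fin m),
      ((nodePoly m c j).map C - C X).map (evalRingHom (x * (x + m - c + 1))) =
        (X - C (x + j + 1)) * (X - C ((c - m - 1 - x) + j + 1)) := by
    intro x j
    simp [nodePoly, colNode]
    ring
  have hD : ∀ x : ℝ, D.map (evalRingHom (x * (x + m - c + 1))) = ∏ i, (X - C (v x i)) := by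
    intro x
    simp only [D, Polynomial.map_prod, hfac, prod_mul_distrib, Fintype.prod_sum_type, v,
      Sum.elim_inl, Sum.elim_inr]
  have hmonic : D.Monic := by
    refine monic_prod_of_monic _ _ fun j _ => ?_
    have : (nodePoly m c j).map C - C X = X ^ 2 + (C (C (m - c - j - j - 1)) * X +
        C (C ((j + 1) * (j - m + c)) - X)) := by
      simp [nodePoly, colNode]
      ring
    rw [this]
    refine monic_X_pow_add ((degree_linear_le).trans_lt ?_)
    norm_num
  let R : ℝ[X] := (P %ₘ D).coeff (#(univ : Finset (Fin m ⊕ Fin m)) - 1)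
  have hR : ∀ x : ℝ, Function.Injective (v x) → R.eval (x * (x + m - c + 1)) =
      ∑ i, (P.map (evalRingHom (x * (x + m - c + 1)))).eval (v x i) /
        ∏ j ∈ univ.erase i, (v x i - v x j) := by
    intro x hinj
    have hmon : (∏ i, (X - C (v x i))).Monic := monic_prod_of_monic _ _ fun j _ => monic_X_sub_C _
    have hdeg : (P.map (evalRingHom (x * (x + m - c + 1))) %ₘ ∏ i, (X - C (v x i))).degree <
        #(univ : Finset (Fin m ⊕ Fin m)) := by
      refine (degree_modByMonic_lt _ hmon).trans_le ?_
      rw [degree_eq_natDegree hmon.ne_zero, natDegree_prod_of_monic _ _ fun _ _ => monic_X_sub_C _]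
      simp
    rw [← coe_evalRingHom, ← coeff_map, map_modByMonic _ hmonic, hD,
      Lagrange.coeff_eq_sum hinj.injOn hdeg]
    refine sum_congr rfl fun i _ => ?_
    congr 1
    refine eval₂_modByMonic_eq_self_of_root (f := RingHom.id ℝ) ?_
    rw [← eval, eval_prod]
    exact prod_eq_zero (mem_univ i) (by simp)
  refine ⟨C ((-1) ^ (m - 1) / 2) * R * C (-1), ?_⟩
  have hgen : ∀ᶠ x in (cofinite : Filter ℝ), ∀ n ∈ Icc (-m : ℤ) m, x - (c - m - 1 - x) ≠ n := by
    refine (eventually_all_finset _).2 fun n _ => ?_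
    filter_upwards [eventually_cofinite_ne (((c - m - 1) + n) / 2)] with x hx h
    exact hx (by linarith)
  have hsh : ∀ᶠ x in (cofinite : Filter ℝ), ∀ j : Fin m,
      K j.rev (c - (x + j + 1)) = -K j (x + j + 1) := by
    refine eventually_all.2 fun j => ?_
    filter_upwards [eventually_comp_affine (hanti j) (j + 1)] with x hx
    rw [add_assoc]
    exact hx
  have h1 : ∀ᶠ x in (cofinite : Filter ℝ), ∀ j : Fin m, ∀ w : ℝ,
      (P.map (evalRingHom w)).eval (x + j + 1 : ℝ) =
        ∑ k, K k (x + j + 1) * ∏ i ∈ univ.erase k, (w - colNode m c (x + j + 1) i) := by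
    refine eventually_all.2 fun j => ?_
    filter_upwards [eventually_comp_affine hP (j + 1)] with x hx
    rw [add_assoc]
    exact hx
  filter_upwards [hgen, hsh, h1, eventually_comp_reflect h1 (c - m - 1)] with x hgen hsh h1 h2
  have hne : x - (c - m - 1 - x) ≠ 0 := by simpa using hgen 0 (by simp)
  have hinj : Function.Injective (v x) := by
    rintro (i | i) (j | j) h
    · simpa [v, Fin.ext_iff] using h
    · refine absurd ?_ (hgen ((j : ℤ) - i) (by rw [mem_Icc]; omega))
      simp only [v, Sum.elim_inl, Sum.elim_inr] at h
      push_cast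
      linarith
    · refine absurd ?_ (hgen ((i : ℤ) - j) (by rw [mem_Icc]; omega))
      simp only [v, Sum.elim_inl, Sum.elim_inr] at h
      push_cast
      linarith
    · simpa [v, Fin.ext_iff] using h
  have hθ : x * (x + m - c + 1) = (c - m - 1 - x) * ((c - m - 1 - x) + m - c + 1) := by ring
  have hsum : ∑ j : Fin m, K j ((c - m - 1 - x) + j + 1) = -∑ j : Fin m, K j (x + j + 1) := by
    rw [← sum_neg_distrib, ← Equiv.sum_comp Fin.revPerm]
    refine sum_congr rfl fun j _ => ?_
    rw [← hsh, Fin.revPerm_apply]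
    congr 1
    rw [Fin.val_rev, Nat.cast_sub (by omega)]
    push_cast
    ring
  have hR' : R.eval (x * (x + m - c + 1)) =
      (-1) ^ (m - 1) * 2 * (∑ j : Fin m, K j (x + j + 1)) / (x - (c - m - 1 - x)) := by
    rw [hR x hinj, Fintype.sum_sum_type]
    have e1 : ∀ k : Fin m, (P.map (evalRingHom (x * (x + m - c + 1)))).eval (v x (Sum.inl k)) /
        ∏ j ∈ univ.erase (Sum.inl k), (v x (Sum.inl k) - v x j) =
        (-1) ^ (m - 1) * K k (x + k + 1) / (x - (c - m - 1 - x)) := by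
      intro k
      rw [erase_inl_eq_disjSum, prod_disjSum, ← summand_at_node c K (by ring) hgen k, ← h1]
      rfl
    have e2 : ∀ k : Fin m, (P.map (evalRingHom (x * (x + m - c + 1)))).eval (v x (Sum.inr k)) /
        ∏ j ∈ univ.erase (Sum.inr k), (v x (Sum.inr k) - v x j) =
        (-1) ^ (m - 1) * K k ((c - m - 1 - x) + k + 1) / ((c - m - 1 - x) - x) := by
      intro k
      have hgen' : ∀ n ∈ Icc (-m : ℤ) m, (c - m - 1 - x) - x ≠ n := by
        intro n hn h
        refine hgen (-n) ?_ ?_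
        · rw [mem_Icc] at hn ⊢
          omega
        · push_cast
          linarith
      rw [erase_inr_eq_disjSum, prod_disjSum, ← summand_at_node c K (by ring) hgen' k, ← h2, ← hθ,
        mul_comm (∏ j : Fin m, _)]
      rfl
    simp only [e1, e2, ← sum_div, ← mul_sum, hsum]
    rw [show (c - m - 1 - x) - x = -(x - (c - m - 1 - x)) by ring, mul_neg, neg_div_neg_eq]
    ring
  have hsq : ((-1 : ℝ) ^ (m - 1)) * (-1) ^ (m - 1) = 1 := by
    rw [← mul_pow]
    simp
  rw [eval_mul, eval_mul, eval_C, eval_C, hR']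
  have : -(2 * x + m - c + 1) = -(x - (c - m - 1 - x)) := by ring
  rw [this]
  field_simp
  linear_combination (-(∑ j : Fin m, K j (x + j + 1))) * hsq

theorem exists_eval_sub_eval_sub_one (W : ℝ[X]) :
    ∃ L : ℝ[X], ∀ x : ℝ, L.eval x - L.eval (x - 1) = W.eval x := by
  induction W using Polynomial.induction_on' with
  | add p q hp hq =>
    obtain ⟨L, hL⟩ := hp
    obtain ⟨L', hL'⟩ := hq
    refine ⟨L + L', fun x => ?_⟩
    rw [eval_add, eval_add, eval_add, ← hL, ← hL']
    ring
  | monomial n a =>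
    have h := congrArg (Polynomial.map (algebraMap ℚ ℝ)) (bernoulli_comp_one_add_X (n + 1))
    refine ⟨C (a / (n + 1)) * ((Polynomial.bernoulli (n + 1)).map (algebraMap ℚ ℝ)).comp (1 + X),
      fun x => ?_⟩
    have hx := congrArg (eval x) h
    simp only [map_comp, Polynomial.map_add, Polynomial.map_one, map_X, eval_comp, eval_add,
      eval_one, eval_X, nsmul_eq_mul, Polynomial.map_mul, Polynomial.map_natCast, eval_mul,
      eval_natCast, Polynomial.map_pow, eval_pow, Nat.add_sub_cancel] at hx
    simp only [eval_mul, eval_C, eval_comp, eval_add, eval_one, eval_X, eval_monomial]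
    rw [hx, show 1 + (x - 1) = x by ring]
    have : (n + 1 : ℝ) ≠ 0 := by positivity
    push_cast
    field_simp
    ring

theorem eval_eq_of_periodic {p : ℝ[X]} (h : ∀ x : ℝ, p.eval (x - 1) = p.eval x) (x y : ℝ) :
    p.eval x = p.eval y := by
  have hn : ∀ n : ℕ, p.eval (n : ℝ) = p.eval 0 := by
    intro n
    induction n with
    | zero => simp
    | succ n ih => rw [← h, ← ih]; simp
  have hp : p = C (p.eval 0) := by
    refine eq_of_infinite_eval_eq _ _ (Set.Infinite.mono ?_
      (Set.infinite_range_of_injective (Nat.cast_injective (R := ℝ))))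
    rintro _ ⟨n, rfl⟩
    simpa using hn n
  rw [hp]
  simp

theorem exists_even_odd (s : ℝ) (E : ℝ[X]) :
    ∃ A B : ℝ[X], ∀ x : ℝ, E.eval x = A.eval (x * (x - s)) + x * B.eval (x * (x - s)) := by
  induction E using Polynomial.induction_on with
  | C a => exact ⟨C a, 0, fun x => by simp⟩
  | add p q hp hq =>
    obtain ⟨A, B, h⟩ := hp
    obtain ⟨A', B', h'⟩ := hq
    refine ⟨A + A', B + B', fun x => ?_⟩
    rw [eval_add, h, h', eval_add, eval_add]
    ring
  | monomial n a ih =>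
    obtain ⟨A, B, h⟩ := ih
    refine ⟨X * B, A + C s * B, fun x => ?_⟩
    rw [pow_succ, ← mul_assoc, eval_mul, h]
    simp only [eval_X, eval_mul, eval_add, eval_C]
    ring

theorem exists_comp_of_symm {s : ℝ} {E : ℝ[X]} (h : ∀ x : ℝ, E.eval (s - x) = E.eval x) :
    ∃ A : ℝ[X], ∀ x : ℝ, A.eval (x * (x - s)) = E.eval x := by
  obtain ⟨A, B, hE⟩ := exists_even_odd s E
  refine ⟨A + C (s / 2) * B, fun x => ?_⟩
  have h1 := h x
  rw [hE, hE, show (s - x) * (s - x - s) = x * (x - s) by ring] at h1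
  rw [hE, eval_add, eval_mul, eval_C]
  linear_combination h1 / 2

theorem exists_telescope (m : ℕ) {c : ℝ} {W : ℝ[X]} (hW : ∀ x : ℝ, W.eval (c - x) = -W.eval x) :
    ∃ L P : ℝ[X], (∀ x : ℝ, L.eval x - L.eval (x - 1) = W.eval x) ∧ ∀ x : ℝ,
      P.eval (x * (x + m - c + 1)) = 2 * L.eval x + ∑ j : Fin m, W.eval (x + j + 1) := by
  obtain ⟨L, hL⟩ := exists_eval_sub_eval_sub_one W
  have hsymm : ∀ x : ℝ, L.eval (c - 1 - x) = L.eval x := by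
    intro x
    have := eval_eq_of_periodic (p := L - L.comp (C (c - 1) - X)) (fun z => by
      have h1 := hL z
      have h2 := hL (c - z)
      rw [hW] at h2
      simp only [eval_sub, eval_comp, eval_C, eval_X]
      rw [show c - 1 - (z - 1) = c - z by ring, show c - 1 - z = c - z - 1 by ring]
      linarith) x ((c - 1) / 2)
    simp only [eval_sub, eval_comp, eval_C, eval_X] at this
    rw [show c - 1 - (c - 1) / 2 = (c - 1) / 2 by ring] at this
    linarith
  have hsum : ∀ x : ℝ, ∑ j : Fin m, W.eval (x + j + 1) = L.eval (x + m) - L.eval x := by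
    intro x
    rw [Fin.sum_univ_eq_sum_range (fun j => W.eval (x + j + 1)) m]
    have := sum_range_sub (fun j : ℕ => L.eval (x + j)) m
    simp only [Nat.cast_zero, add_zero] at this
    rw [← this]
    refine sum_congr rfl fun j _ => ?_
    rw [← hL]
    push_cast
    ring_nf
  obtain ⟨P, hP⟩ := exists_comp_of_symm (s := c - m - 1) (E := L + L.comp (X + C (m : ℝ)))
    fun x => by
      simp only [eval_add, eval_comp, eval_X, eval_C]
      rw [← hsymm (c - m - 1 - x), ← hsymm (c - m - 1 - x + m)]
      ring_nf
  refine ⟨L, P, hL, fun x => ?_⟩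
  rw [hsum, show x * (x + m - c + 1) = x * (x - (c - m - 1)) by ring, hP]
  simp only [eval_add, eval_comp, eval_X, eval_C]
  ring

theorem neg_one_pow_mul_minorDet {m : ℕ} (A : Matrix (Fin m) (Fin m) ℝ) (h j : Fin m) :
    (-1) ^ ((h : ℕ) + (j : ℕ)) * minorDet m A h j = A.adjugate j h := by
  cases m with
  | zero => exact h.elim0
  | succ n => rw [Matrix.adjugate_fin_succ_eq_det_submatrix, minorDet]

theorem sum_mul_adjugate_eq_det_update {m : ℕ} (κ f : Fin m → Fin m → ℝ) (h : Fin m)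
    (g : Fin m → ℝ) :
    ∑ j, κ h j * g j * (Matrix.of fun l r => κ l r * f l r).adjugate j h =
      (Matrix.of fun l r => κ l r * Function.update f h g l r).det := by
  rw [Matrix.det_eq_sum_mul_adjugate_row _ h]
  refine sum_congr rfl fun j _ => ?_
  rw [Matrix.adjugate_apply, Matrix.adjugate_apply]
  congr 2
  · simp
  · ext l r
    by_cases hl : l = h
    · subst hl
      simp
    · simp [hl]

/-- The summand of `M_h(x)` at `y = x + j + 1`. -/
noncomputable def minorTerm {m : ℕ} (c : ℝ) (S : ℝ → ℝ) (κ : Fin m → Fin m → ℝ → ℝ)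
    (Y : Fin m → ℝ[X]) (h j : Fin m) (y : ℝ) : ℝ :=
  S y * κ h j y *
    (Matrix.of fun l r : Fin m => κ l r y * (Y l).eval (colNode m c y r)).adjugate j h

theorem sum_minorTerm_mul {m : ℕ} (c : ℝ) (S : ℝ → ℝ) (κ : Fin m → Fin m → ℝ → ℝ)
    (Y : Fin m → ℝ[X]) (h : Fin m) (y : ℝ) (g : Fin m → ℝ) :
    ∑ j, minorTerm c S κ Y h j y * g j = S y * (Matrix.of fun l r : Fin m =>
      κ l r y * Function.update (fun l r : Fin m => (Y l).eval (colNode m c y r)) h g l r).det := by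
  rw [← sum_mul_adjugate_eq_det_update (fun l r => κ l r y), mul_sum]
  refine sum_congr rfl fun j _ => ?_
  rw [minorTerm]
  ring

theorem sum_eval_mul_minorTerm {m : ℕ} (c : ℝ) (S : ℝ → ℝ) (κ : Fin m → Fin m → ℝ → ℝ)
    (Y : Fin m → ℝ[X]) (j : Fin m) (y : ℝ) :
    ∑ h, (Y h).eval (colNode m c y j) * minorTerm c S κ Y h j y = S y *
      (Matrix.of fun l r : Fin m => κ l r y * (Y l).eval (colNode m c y r)).det := by
  rw [Matrix.det_eq_sum_mul_adjugate_col _ j, mul_sum]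
  refine sum_congr rfl fun h _ => ?_
  rw [minorTerm, Matrix.of_apply]
  ring

section Transfer

variable {m : ℕ} {c : ℝ} {S : ℝ → ℝ} {κ : Fin m → Fin m → ℝ → ℝ}

theorem exists_sum_minorTerm_eq
    (hF : ∀ Y : Fin m → ℝ[X], ∃ W : ℝ[X], ∀ᶠ y in (cofinite : Filter ℝ),
      S y * (Matrix.of fun l j : Fin m => κ l j y * (Y l).eval (colNode m c y j)).det = W.eval y)
    (hR : ∀ᶠ y in (cofinite : Filter ℝ), ∀ f : Fin m → Fin m → ℝ,
      S (c - y) * (Matrix.of fun l j => κ l j (c - y) * f l j).det =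
        -(S y * (Matrix.of fun l j => κ l j y * f l j.rev).det))
    (Y : Fin m → ℝ[X]) (h : Fin m) :
    ∃ R : ℝ[X], ∀ᶠ x in (cofinite : Filter ℝ), ∑ j : Fin m, minorTerm c S κ Y h j (x + j + 1) =
      -(2 * x + m - c + 1) * R.eval (x * (x + m - c + 1)) := by
  refine exists_sum_shift_eq c (minorTerm c S κ Y h) (fun g => ?_) fun j => ?_
  · obtain ⟨W, hW⟩ := hF (Function.update Y h g)
    refine ⟨W, hW.mono fun y hy => ?_⟩
    rw [sum_minorTerm_mul, ← hy]
    congr 3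
    ext l r
    by_cases hl : l = h
    · subst hl
      simp
    · simp [hl]
  · filter_upwards [hR] with y hy
    have hsingle : ∀ (k : Fin m) (z : ℝ), minorTerm c S κ Y h k z =
        S z * (Matrix.of fun l r : Fin m => κ l r z *
          Function.update (fun l r : Fin m => (Y l).eval (colNode m c z r)) h
            (Pi.single k 1) l r).det := by
      intro k z
      rw [← sum_minorTerm_mul]
      simp [Pi.single_apply]
    rw [hsingle, hsingle, hy]
    congr 4
    ext l r
    by_cases hl : l = h
    · subst hl
      simp [Pi.single_apply]
    · have hr : ((r.rev : Fin m) : ℕ) = m - 1 - r := by rw [Fin.val_rev]; omega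
      have := colNode_reflect c y r.rev.2
      rw [hr, show m - 1 - (m - 1 - (r : ℕ)) = r by omega] at this
      simp only [Function.update_of_ne hl, hr, this]

theorem exists_telescope_of_antisymm
    (hR : ∀ᶠ y in (cofinite : Filter ℝ), ∀ f : Fin m → Fin m → ℝ,
      S (c - y) * (Matrix.of fun l j => κ l j (c - y) * f l j).det =
        -(S y * (Matrix.of fun l j => κ l j y * f l j.rev).det))
    {Y : Fin m → ℝ[X]} {W : ℝ[X]} (hW : ∀ᶠ y in (cofinite : Filter ℝ),
      S y * (Matrix.of fun l j : Fin m => κ l j y * (Y l).eval (colNode m c y j)).det =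
        W.eval y) :
    ∃ L P : ℝ[X], (∀ x : ℝ, L.eval x - L.eval (x - 1) = W.eval x) ∧
      ∀ᶠ x in (cofinite : Filter ℝ), P.eval (x * (x + m - c + 1)) = 2 * L.eval x +
        ∑ h, (Y h).eval (x * (x + m - c + 1)) *
          ∑ j : Fin m, minorTerm c S κ Y h j (x + j + 1) := by
  have hanti : W.comp (C c - X) = -W := by
    refine eq_of_infinite_eval_eq _ _ ?_
    have : ∀ᶠ y in (cofinite : Filter ℝ), (W.comp (C c - X)).eval y = (-W).eval y := by
      filter_upwards [hR, hW, eventually_comp_reflect hW c] with y h1 h2 h3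
      rw [eval_comp, eval_sub, eval_C, eval_X, ← h3, h1, eval_neg, ← h2]
      congr 4
      ext l r
      have hr : ((r.rev : Fin m) : ℕ) = m - 1 - r := by rw [Fin.val_rev]; omega
      have := colNode_reflect c y r.rev.2
      rw [hr, show m - 1 - (m - 1 - (r : ℕ)) = r by omega] at this
      simp only [hr, this]
    exact Set.infinite_of_finite_compl this
  obtain ⟨L, P, hL, hP⟩ := exists_telescope m (c := c) (W := W) fun x => by
    have := congrArg (eval x) hanti
    simpa using this
  refine ⟨L, P, hL, ?_⟩
  have h1 : ∀ᶠ x in (cofinite : Filter ℝ), ∀ j : Fin m, S (x + j + 1) * (Matrix.of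
      fun l r : Fin m => κ l r (x + j + 1) * (Y l).eval (colNode m c (x + j + 1) r)).det =
        W.eval (x + j + 1 : ℝ) := by
    refine eventually_all.2 fun j => ?_
    filter_upwards [eventually_comp_affine hW (j + 1)] with x hx
    rw [add_assoc]
    exact hx
  filter_upwards [h1] with x h1
  simp only [hP, mul_sum]
  rw [sum_comm]
  congr 1
  refine sum_congr rfl fun j _ => ?_
  rw [← h1, ← sum_eval_mul_minorTerm c S κ Y j]
  refine sum_congr rfl fun h _ => ?_
  congr 2
  rw [colNode]
  ring

end Transfer

theorem eventually_prod_ne_zero {ι : Type*} (s : Finset ι) {f : ι → ℝ → ℝ}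
    (h : ∀ i ∈ s, ∀ᶠ y in (cofinite : Filter ℝ), f i y ≠ 0) :
    ∀ᶠ y in (cofinite : Filter ℝ), ∏ i ∈ s, f i y ≠ 0 := by
  filter_upwards [(eventually_all_finset s).2 h] with y hy
  exact prod_ne_zero_iff.2 hy

theorem exists_finset_of_eventually_cofinite {p : ℝ → Prop}
    (h : ∀ᶠ x in (cofinite : Filter ℝ), p x) : ∃ E : Finset ℝ, ∀ x ∉ E, p x := by
  refine ⟨(eventually_cofinite.1 h).toFinset, fun x hx => ?_⟩
  simpa using hx

section HahnScale

variable {a b N : ℝ} {m1 m2 m3 m4 m : ℕ} {Ξ : ℝ[X]} {S : ℝ → ℝ}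

theorem eventually_hahn_det_eq (hm : m = m1 + m2 + m3 + m4)
    (hS : ∀ x : ℝ, S x = -(2 * x - (m - a - b)) * Ξ.eval x *
      (DD1 a (m - 1) (x - 1)) ^ (m2 + m4) * (DD2 a b N (m - 1) (x - 1)) ^ (m1 + m2) /
      (pDen a b N m1 m2 m3 m4 x * qDen a b m x)) :
    ∀ᶠ y in (cofinite : Filter ℝ), ∀ f : Fin m → Fin m → ℝ,
      S y * (Matrix.of fun l j : Fin m =>
        xiBlock a b N m1 m2 m3 l (y - j - 1) (m - j - 1) * f l j).det =
      -(2 * y - (m - a - b)) * Ξ.eval y / (pDen a b N m1 m2 m3 m4 y * qDen a b m y) *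
        (Matrix.of fun l j : Fin m => hahnWeight a b N m1 m2 m3 l j y * f l j).det := by
  have hne : ∀ α : ℝ, ∀ᶠ y in (cofinite : Filter ℝ), ∏ s ∈ range (m - 1), (α + s - y) ≠ 0 := by
    refine fun α => eventually_prod_ne_zero _ fun s _ => ?_
    filter_upwards [eventually_cofinite_ne (α + s)] with y hy
    exact sub_ne_zero.2 hy.symm
  filter_upwards [hne (1 - a), hne (-a - b - N)] with y h1 h2 f
  rw [← scale_mul_det_xiBlock hm (by rwa [DD1_eq_prod]) (by rwa [DD2_eq_prod]), hS]
  ring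

theorem exists_eventually_hahn_det_eq_eval (hm : m = m1 + m2 + m3 + m4)
    (hS : ∀ x : ℝ, S x = -(2 * x - (m - a - b)) * Ξ.eval x *
      (DD1 a (m - 1) (x - 1)) ^ (m2 + m4) * (DD2 a b N (m - 1) (x - 1)) ^ (m1 + m2) /
      (pDen a b N m1 m2 m3 m4 x * qDen a b m x)) (Y : Fin m → ℝ[X]) :
    ∃ W : ℝ[X], ∀ᶠ y in (cofinite : Filter ℝ),
      S y * (Matrix.of fun l j : Fin m => xiBlock a b N m1 m2 m3 l (y - j - 1) (m - j - 1) *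
        (Y l).eval (colNode m (m - a - b) y j)).det = W.eval y := by
  obtain ⟨V, hV⟩ := exists_det_hahnMat_eq (rowsA m m1 m2 m3) (rowsB m m1 m2) Y (m - a - b)
    (1 - a) (-a - b - N)
  obtain ⟨u, hu, hpq⟩ := pDen_mul_qDen_eq (a := a) (b := b) (N := N) hm
  rw [card_rowsA hm, card_rowsB hm] at hV
  refine ⟨C (u⁻¹) * (C (m - a - b) - C 2 * X) * Ξ * V, ?_⟩
  have hne : ∀ᶠ y in (cofinite : Filter ℝ), ∏ f : Fin 5, ∏ t ∈ range (2 * m),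
      (y - rootVal m (m - a - b) (1 - a) (-a - b - N) f t) ^
        rootExp m (m2 + m4) (m1 + m2) f t ≠ 0 := by
    refine eventually_prod_ne_zero _ fun f _ => eventually_prod_ne_zero _ fun t _ => ?_
    filter_upwards [eventually_cofinite_ne (rootVal m (m - a - b) (1 - a) (-a - b - N) f t)]
      with y hy
    exact pow_ne_zero _ (sub_ne_zero.2 hy)
  filter_upwards [eventually_hahn_det_eq hm hS, hne] with y hy hne
  have hmat : (Matrix.of fun l j : Fin m => hahnWeight a b N m1 m2 m3 l j y *
      (Y l).eval (colNode m (m - a - b) y j)) =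
        hahnMat (rowsA m m1 m2 m3) (rowsB m m1 m2) Y (m - a - b : ℝ) (1 - a) (-a - b - N) y := by
    ext l j
    simp [hahnMat, hahnWeight, coe_aeval_eq_eval]
  rw [hy, hmat, hV, hpq]
  simp only [eval_mul, eval_C, eval_sub, eval_X]
  field_simp
  ring

theorem eventually_hahn_det_reflect (hm : m = m1 + m2 + m3 + m4)
    (hΞ : Iinv (a + b - (m : ℝ) - 1) Ξ = Ξ)
    (hS : ∀ x : ℝ, S x = -(2 * x - (m - a - b)) * Ξ.eval x *
      (DD1 a (m - 1) (x - 1)) ^ (m2 + m4) * (DD2 a b N (m - 1) (x - 1)) ^ (m1 + m2) /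
      (pDen a b N m1 m2 m3 m4 x * qDen a b m x)) :
    ∀ᶠ y in (cofinite : Filter ℝ), ∀ f : Fin m → Fin m → ℝ,
      S (m - a - b - y) * (Matrix.of fun l j : Fin m =>
        xiBlock a b N m1 m2 m3 l (m - a - b - y - j - 1) (m - j - 1) * f l j).det =
      -(S y * (Matrix.of fun l j : Fin m =>
        xiBlock a b N m1 m2 m3 l (y - j - 1) (m - j - 1) * f l j.rev).det) := by
  have h := eventually_hahn_det_eq hm hS
  filter_upwards [h, eventually_comp_reflect h (m - a - b)] with y h1 h2 f
  have hΞy : Ξ.eval (m - a - b - y) = Ξ.eval y := by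
    have := congrArg (eval y) hΞ
    rw [Iinv, eval_comp] at this
    rw [← this]
    congr 1
    simp only [eval_neg, eval_add, eval_X, eval_C]
    ring
  have hdet : (Matrix.of fun l j : Fin m =>
      hahnWeight a b N m1 m2 m3 l j (m - a - b - y) * f l j).det =
      ((Equiv.Perm.sign (Fin.revPerm (n := m)) : ℤ) : ℝ) *
        (Matrix.of fun l j : Fin m => hahnWeight a b N m1 m2 m3 l j y * f l j.rev).det := by
    rw [← Matrix.det_permute']
    congr 1
    ext l j
    simp [hahnWeight_reflect]
  rw [h1, h2, hdet, hΞy, qDen_reflect, pDen_eq hm, halfDen_reflect, halfDen_reflect, ← pDen_eq hm]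
  rcases Int.units_eq_one_or (Equiv.Perm.sign (Fin.revPerm (n := m))) with hs | hs
  · rw [hs]
    push_cast
    ring
  · rw [hs]
    push_cast
    rw [neg_one_mul, mul_neg, div_neg]
    ring

end HahnScale

end Cofinite

/-- Lemma 5.2: for the Hahn family, with `S` defined from an `ℐ^{a+b−m−1}`-invariant
polynomial `Ξ`, the three hypotheses of Theorem 3.1 hold (as identities of rational
functions of `x`, i.e. away from a finite set). -/
theorem hahn_hypotheses_of_theorem31
    (a b N : ℝ) (m1 m2 m3 m4 m : ℕ)
    (hm : m = m1 + m2 + m3 + m4) (hm1 : 1 ≤ m)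
    (Y : Fin m → Polynomial ℝ)
    (θ : ℝ → ℝ) (hθ : ∀ x, θ x = x * (x + a + b + 1))
    (σ : ℝ → ℝ) (hσ : ∀ x, σ x = -(2 * x + a + b - 1))
    (Ω : ℝ → ℝ)
    (hΩ : ∀ x : ℝ, Ω x = Matrix.det (Matrix.of fun l j : Fin m =>
      xiBlock a b N m1 m2 m3 l (x - (j : ℝ) - 1) (m - (j : ℕ) - 1) *
        (Y l).eval (θ (x - (j : ℝ) - 1))))
    (Ξ : Polynomial ℝ)
    (hΞ : Iinv (a + b - (m : ℝ) - 1) Ξ = Ξ)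
    (S : ℝ → ℝ)
    (hS : ∀ x : ℝ, S x = σ (x - ((m : ℝ) - 1) / 2) * Ξ.eval x *
      (DD1 a (m - 1) (x - 1)) ^ (m2 + m4) * (DD2 a b N (m - 1) (x - 1)) ^ (m1 + m2) /
      (pDen a b N m1 m2 m3 m4 x * qDen a b m x))
    (M : Fin m → ℝ → ℝ)
    (hM : ∀ h (x : ℝ), M h x = ∑ j : Fin m,
      (-1 : ℝ) ^ ((h : ℕ) + (j : ℕ)) * xiBlock a b N m1 m2 m3 h x (m - (j : ℕ) - 1) *
        S (x + (j : ℝ) + 1) *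
        minorDet m (Matrix.of fun l r : Fin m =>
          xiBlock a b N m1 m2 m3 l (x + (j : ℝ) - (r : ℝ)) (m - (r : ℕ) - 1) *
            (Y l).eval (θ (x + (j : ℝ) - (r : ℝ)))) h j) :
    -- (i) S·Ω is a polynomial in x
    (∃ (W : Polynomial ℝ) (E : Finset ℝ), ∀ x : ℝ, x ∉ E → S x * Ω x = W.eval x)
      -- (ii) M_h(x) = σ_{x+1} M̃_h(θ_x) with M̃_h a polynomial
      ∧ (∀ h : Fin m, ∃ (Mt : Polynomial ℝ) (E : Finset ℝ), ∀ x : ℝ, x ∉ E →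
          M h x = σ (x + 1) * Mt.eval (θ x))
      -- (iii) there are λ and a polynomial P_S with λ_x − λ_{x−1} = S(x)Ω(x) and
      -- P_S(θ_x) = 2λ_x + Σ_h Y_h(θ_x)M_h(x)
      ∧ ∃ (Λ : ℝ → ℝ) (PS : Polynomial ℝ) (E : Finset ℝ),
          (∀ x : ℝ, x ∉ E → Λ x - Λ (x - 1) = S x * Ω x)
            ∧ ∀ x : ℝ, x ∉ E →
                PS.eval (θ x) = 2 * Λ x + ∑ h : Fin m, (Y h).eval (θ x) * M h x := by
  let κ : Fin m → Fin m → ℝ → ℝ := fun l j y =>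
    xiBlock a b N m1 m2 m3 l (y - (j : ℝ) - 1) (m - (j : ℕ) - 1)
  have hS' : ∀ x : ℝ, S x = -(2 * x - (m - a - b)) * Ξ.eval x *
      (DD1 a (m - 1) (x - 1)) ^ (m2 + m4) * (DD2 a b N (m - 1) (x - 1)) ^ (m1 + m2) /
      (pDen a b N m1 m2 m3 m4 x * qDen a b m x) := by
    intro x
    rw [hS, hσ, show -(2 * (x - ((m : ℝ) - 1) / 2) + a + b - 1) = -(2 * x - (m - a - b)) by ring]
  have hF := exists_eventually_hahn_det_eq_eval hm hS'
  have hR := eventually_hahn_det_reflect hm hΞ hS'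
  have hθ' : ∀ x : ℝ, θ x = x * (x + m - (m - a - b) + 1) := fun x => by rw [hθ]; ring
  have hσ' : ∀ x : ℝ, σ (x + 1) = -(2 * x + m - (m - a - b) + 1) := fun x => by rw [hσ]; ring
  have hnode : ∀ (x : ℝ) (j : Fin m), θ (x - (j : ℝ) - 1) = colNode m (m - a - b) x j := by
    intro x j
    rw [hθ, colNode]
    ring
  have hM' : ∀ (h : Fin m) (x : ℝ),
      M h x = ∑ j : Fin m, minorTerm (m - a - b) S κ Y h j (x + j + 1) := by
    intro h x
    rw [hM]
    refine sum_congr rfl fun j _ => ?_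
    simp only [minorTerm, κ, ← hnode, ← neg_one_pow_mul_minorDet]
    have e1 : x + (j : ℝ) + 1 - j - 1 = x := by ring
    have e2 : ∀ r : Fin m, x + (j : ℝ) + 1 - r - 1 = x + j - r := fun r => by ring
    simp only [e1, e2]
    ring
  obtain ⟨W, hW⟩ := hF Y
  have hWΩ : ∀ᶠ x in Filter.cofinite, S x * Ω x = W.eval x := by
    filter_upwards [hW] with x hx
    rw [← hx, hΩ]
    simp only [hnode]
  refine ⟨⟨W, exists_finset_of_eventually_cofinite hWΩ⟩, fun h => ?_, ?_⟩
  · obtain ⟨R, hR⟩ := exists_sum_minorTerm_eq (κ := κ) hF hR Y h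
    refine ⟨R, exists_finset_of_eventually_cofinite ?_⟩
    filter_upwards [hR] with x hx
    rw [hM', hx, hσ', hθ']
  · obtain ⟨L, P, hL, hP⟩ := exists_telescope_of_antisymm (κ := κ) hR hW
    have : ∀ᶠ x in Filter.cofinite, (L.eval x - L.eval (x - 1) = S x * Ω x) ∧
        P.eval (θ x) = 2 * L.eval x + ∑ h : Fin m, (Y h).eval (θ x) * M h x := by
      filter_upwards [hWΩ, hP] with x h1 h2
      refine ⟨by rw [h1, hL], ?_⟩
      simp only [hM', hθ', h2]
    obtain ⟨E, hE⟩ := exists_finset_of_eventually_cofinite this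
    exact ⟨fun x => L.eval x, P, E, fun x hx => (hE x hx).1, fun x hx => (hE x hx).2⟩
end

section
/- Let a, b, N be real numbers and θ_n = n(n+a+b+1). Define the dual Hahn polynomials Z_j^1(x) = R_j^{−b,−a,a+b+N}(x+a+b), Z_j^2(x) = R_j^{−a,−b,a+b+N}(x+a+b), Z_j^3(x) = R_j^{−b,−a,−2−N}(x+a+b), Z_j^4(x) = R_j^{−a,−b,−2−N}(x+a+b), and set ε_n^1 = −(n−N−1)/(n+a+b+N+1) with η_1 = 1, κ_1 = −b−N; ε_n^2 = (n−N−1)(n+b)/[(n+a)(n+a+b+N+1)] with η_2 = −1, κ_2 = a; ε_n^3 = 1 with η_3 = −1, κ_3 = −N−1; ε_n^4 = −(n+b)/(n+a) with η_4 = 1, κ_4 = 1. Let a_n, b_n, c_n be the three-term recurrence coefficients of the Hahn polynomials h_n^{a,b,N}: a_n = −n(n+a)(n+a+b+N+1)/[(2n+a+b−1)(2n+a+b)], b_n = [N(a+1)(a+b)+n(2N+b−a)(n+a+b+1)]/[(2n+a+b)(2n+a+b+2)], c_n = −(n+a+b)(n+b)(N−n+1)/[(2n+a+b)(2n+a+b+1)].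 Then for each h ∈ {1,2,3,4}, each j ≥ 0, and each integer n for which all denominators occurring in ε_n^h, ε_{n+1}^h, a_{n+1}, b_n, c_n are nonzero and ε_n^h ≠ 0, one has ε^h_{n+1} a_{n+1} Z_j^h(θ_{n+1}) − b_n Z_j^h(θ_n) + (c_n/ε_n^h) Z_j^h(θ_{n−1}) = (η_h j + κ_h) Z_j^h(θ_n). (For the definition of Z_j^1, Z_j^3 assume b ∉ {1,2,…}; for Z_j^2, Z_j^4 assume a ∉ {1,2,…}.) -/
open Polynomial Finset

/-- The dual Hahn polynomial
`R_n^{a,b,N}(x) = Σ_{j=0}^n [(−1)^j (−n)_j (−N+j)_{n−j} / ((a+1)_j j!)]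
  ∏_{i=0}^{j−1}[x − i(i+a+b+1)]`. -/
noncomputable def dualHahn (a b N : ℝ) (n : ℕ) (x : ℝ) : ℝ :=
  ∑ j ∈ Finset.range (n + 1),
    ((-1 : ℝ) ^ j * pch j (-(n : ℝ)) * pch (n - j) (-N + (j : ℝ)) /
      (pch j (a + 1) * (Nat.factorial j : ℝ))) *
      ∏ i ∈ Finset.range j, (x - (i : ℝ) * ((i : ℝ) + a + b + 1))

/-- The four families of dual Hahn polynomials `Z_j^1, Z_j^2, Z_j^3, Z_j^4`. -/
noncomputable def Zdual (a b N : ℝ) (h : Fin 4) (j : ℕ) (x : ℝ) : ℝ :=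
  if h = 0 then dualHahn (-b) (-a) (a + b + N) j (x + a + b)
  else if h = 1 then dualHahn (-a) (-b) (a + b + N) j (x + a + b)
  else if h = 2 then dualHahn (-b) (-a) (-2 - N) j (x + a + b)
  else dualHahn (-a) (-b) (-2 - N) j (x + a + b)

/-- The sequences `ε_n^h`, `h = 1,2,3,4`. -/
noncomputable def epsFour (a b N : ℝ) (h : Fin 4) (t : ℝ) : ℝ :=
  if h = 0 then -(t - N - 1) / (t + a + b + N + 1)
  else if h = 1 then (t - N - 1) * (t + b) / ((t + a) * (t + a + b + N + 1))
  else if h = 2 then 1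
  else -(t + b) / (t + a)

/-- The constants `η_h`. -/
noncomputable def etaFour (h : Fin 4) : ℝ :=
  if h = 0 then 1 else if h = 1 then -1 else if h = 2 then -1 else 1

/-- The constants `κ_h`. -/
noncomputable def kappaFour (a b N : ℝ) (h : Fin 4) : ℝ :=
  if h = 0 then -b - N else if h = 1 then a else if h = 2 then -N - 1 else 1

/-- Nonvanishing of the denominators occurring in `ε_t^h`. -/
def epsFourDenom (a b N : ℝ) (h : Fin 4) (t : ℝ) : Prop :=
  if h = 0 then t + a + b + N + 1 ≠ 0
  else if h = 1 then t + a ≠ 0 ∧ t + a + b + N + 1 ≠ 0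
  else if h = 2 then True
  else t + a ≠ 0

/-- Shifting the spectral variable up in the products defining the dual Hahn polynomials. -/
lemma prod_shift_up (s t : ℝ) (k : ℕ) :
    (t + 1) * ∏ i ∈ range (k + 1), ((t + 1) * (t + 1 + s + 1) + s - (i : ℝ) * ((i : ℝ) - s + 1)) =
      (s + t + 1) * (t + k + 1) * (t + k + 2) *
        ∏ i ∈ range k, (t * (t + s + 1) + s - (i : ℝ) * ((i : ℝ) - s + 1)) := by
  induction k with
  | zero => simp; ring
  | succ k ih =>
    rw [prod_range_succ, ← mul_assoc, ih, prod_range_succ _ k]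
    push_cast
    ring

/-- Shifting the spectral variable down in the products defining the dual Hahn polynomials. -/
lemma prod_shift_down (s t : ℝ) (k : ℕ) :
    (t + s) * ∏ i ∈ range (k + 1), ((t - 1) * (t - 1 + s + 1) + s - (i : ℝ) * ((i : ℝ) - s + 1)) =
      t * (t + s - k - 1) * (t + s - k) *
        ∏ i ∈ range k, (t * (t + s + 1) + s - (i : ℝ) * ((i : ℝ) - s + 1)) := by
  induction k with
  | zero => simp; ring
  | succ k ih =>
    rw [prod_range_succ, ← mul_assoc, ih, prod_range_succ _ k]
    push_cast
    ring

lemma pch_succ_right (k : ℕ) (z : ℝ) : pch (k + 1) z = pch k z * (z + k) := by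
  simp [pch, ascPochhammer_succ_eval]

lemma pch_succ_left (k : ℕ) (z : ℝ) : pch (k + 1) z = z * pch k (z + 1) := by
  simp [pch, ascPochhammer_succ_left]

lemma pch_ne_zero {z : ℝ} (hz : ∀ k : ℕ, z + k ≠ 0) (k : ℕ) : pch k z ≠ 0 := by
  induction k with
  | zero => simp [pch]
  | succ k ih => rw [pch_succ_right]; exact mul_ne_zero ih (hz k)

/-- The coefficient of the `k`-th product in the dual Hahn polynomial of degree `j`. -/
noncomputable def dualHahnCoeff (α M : ℝ) (j k : ℕ) : ℝ :=
  (-1 : ℝ) ^ k * pch k (-(j : ℝ)) * pch (j - k) (-M + (k : ℝ)) /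
    (pch k (α + 1) * (Nat.factorial k : ℝ))

lemma dualHahnCoeff_succ {α : ℝ} (hα : ∀ k : ℕ, α + 1 + k ≠ 0) (M : ℝ) {j k : ℕ} (hk : k < j) :
    (k - M) * (k + 1 + α) * (k + 1) * dualHahnCoeff α M j (k + 1) =
      (j - k) * dualHahnCoeff α M j k := by
  obtain ⟨m, rfl⟩ := Nat.exists_eq_add_of_lt hk
  have e₁ : k + m + 1 - (k + 1) = m := by omega
  have e₂ : k + m + 1 - k = m + 1 := by omega
  have h₁ := pch_ne_zero hα k
  have h₂ := hα k
  have h₃ : (Nat.factorial k : ℝ) ≠ 0 := by positivity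
  have h₄ : (k : ℝ) + 1 ≠ 0 := by positivity
  have e₃ : -M + ((k + 1 : ℕ) : ℝ) = -M + k + 1 := by push_cast; ring
  unfold dualHahnCoeff
  rw [e₁, e₂, pch_succ_right k, pch_succ_right k, pch_succ_left m, Nat.factorial_succ, e₃]
  generalize pch k (α + 1) = p at *
  push_cast
  field_simp
  ring

lemma dualHahn_eq_sum (α β M : ℝ) (j : ℕ) (x : ℝ) :
    dualHahn α β M j x = ∑ k ∈ range (j + 1), dualHahnCoeff α M j k *
      ∏ i ∈ range k, (x - (i : ℝ) * ((i : ℝ) - (-α - β) + 1)) := by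
  unfold dualHahn dualHahnCoeff
  refine sum_congr rfl fun k _ => ?_
  congr 1
  refine prod_congr rfl fun i _ => ?_
  ring

/-- A three-term difference operator acting triangularly on the products has the dual Hahn
polynomials as eigenfunctions. -/
lemma dualHahn_difference {α s M t A B C η κ : ℝ} (hα : ∀ k : ℕ, α + 1 + k ≠ 0) (β : ℝ)
    (hs : s = -α - β)
    (h₀ : (t + 1) * A - B + (t + s) * C = κ)
    (h₁ : ∀ k : ℝ, A * ((s + t + 1) * (t + k + 1) * (t + k + 2)) -
        B * ((t + k + 1) * (t + s - k)) + C * (t * (t + s - k - 1) * (t + s - k)) =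
      (η * (k + 1) + κ) * ((t + k + 1) * (t + s - k)) + η * (k - M) * (k + 1 + α) * (k + 1))
    (j : ℕ) :
    (t + 1) * A * dualHahn α β M j ((t + 1) * (t + 1 + s + 1) + s)
        - B * dualHahn α β M j (t * (t + s + 1) + s)
        + (t + s) * C * dualHahn α β M j ((t - 1) * (t - 1 + s + 1) + s) =
      (η * j + κ) * dualHahn α β M j (t * (t + s + 1) + s) := by
  simp only [dualHahn_eq_sum, ← hs]
  set P : ℝ → ℕ → ℝ := fun x k => ∏ i ∈ range k, (x - (i : ℝ) * ((i : ℝ) - s + 1)) with hP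
  set w := dualHahnCoeff α M j
  have hzero : (t + 1) * A * P ((t + 1) * (t + 1 + s + 1) + s) 0
      - B * P (t * (t + s + 1) + s) 0
      + (t + s) * C * P ((t - 1) * (t - 1 + s + 1) + s) 0 = κ * P (t * (t + s + 1) + s) 0 := by
    simp only [hP, range_zero, prod_empty]
    linear_combination h₀
  have hsucc : ∀ k : ℕ, (t + 1) * A * P ((t + 1) * (t + 1 + s + 1) + s) (k + 1)
      - B * P (t * (t + s + 1) + s) (k + 1)
      + (t + s) * C * P ((t - 1) * (t - 1 + s + 1) + s) (k + 1) =
        (η * (k + 1) + κ) * P (t * (t + s + 1) + s) (k + 1) +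
          η * ((k - M) * (k + 1 + α) * (k + 1)) * P (t * (t + s + 1) + s) k := by
    intro k
    have hmid : P (t * (t + s + 1) + s) (k + 1) =
        (t + k + 1) * (t + s - k) * P (t * (t + s + 1) + s) k := by
      simp only [hP, prod_range_succ]
      ring
    linear_combination A * prod_shift_up s t k + C * prod_shift_down s t k +
      (-B - (η * (k + 1) + κ)) * hmid + P (t * (t + s + 1) + s) k * h₁ k
  have partial_sum : ∀ m ≤ j, ∑ k ∈ range (m + 1),
      w k * ((t + 1) * A * P ((t + 1) * (t + 1 + s + 1) + s) k
        - B * P (t * (t + s + 1) + s) k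
        + (t + s) * C * P ((t - 1) * (t - 1 + s + 1) + s) k) =
      (η * j + κ) * ∑ k ∈ range (m + 1), w k * P (t * (t + s + 1) + s) k
        - η * (j - m) * w m * P (t * (t + s + 1) + s) m := by
    intro m
    induction m with
    | zero =>
      intro _
      simp only [zero_add, sum_range_one, Nat.cast_zero]
      linear_combination w 0 * hzero
    | succ m ih =>
      intro hm
      rw [sum_range_succ, ih (by omega), sum_range_succ _ (m + 1), hsucc]
      push_cast
      linear_combination η * P (t * (t + s + 1) + s) m * dualHahnCoeff_succ hα M (k := m) hm
  have key := partial_sum j le_rfl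
  rw [sub_self, mul_zero, zero_mul, zero_mul, sub_zero] at key
  rw [← key]
  simp only [mul_sum, ← sum_sub_distrib, ← sum_add_distrib]
  refine sum_congr rfl fun k _ => ?_
  ring


lemma three_term_div_eq {p X Y Z R : ℝ} (h₀ : p ≠ 0) (h₁ : p + 1 ≠ 0) (h₂ : p + 2 ≠ 0)
    (h : X * p - Y * (p + 1) + Z * (p + 2) = R * p * (p + 1) * (p + 2)) :
    X / ((p + 1) * (p + 2)) - Y / (p * (p + 2)) + Z / (p * (p + 1)) = R := by
  field_simp
  linear_combination h

/-- `dualHahn_difference` for the denominators of the Hahn recurrence coefficients. -/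
lemma dualHahn_difference_div {α s M t X Y Z η κ : ℝ} (hα : ∀ k : ℕ, α + 1 + k ≠ 0) (β : ℝ)
    (hs : s = -α - β) {p : ℝ} (hp₀ : p ≠ 0) (hp₁ : p + 1 ≠ 0) (hp₂ : p + 2 ≠ 0)
    (h₀ : (t + 1) * X * p - Y * (p + 1) + (t + s) * Z * (p + 2) = κ * p * (p + 1) * (p + 2))
    (h₁ : ∀ k : ℝ, X * ((s + t + 1) * (t + k + 1) * (t + k + 2)) * p -
        Y * ((t + k + 1) * (t + s - k)) * (p + 1) +
        Z * (t * (t + s - k - 1) * (t + s - k)) * (p + 2) =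
      ((η * (k + 1) + κ) * ((t + k + 1) * (t + s - k)) + η * (k - M) * (k + 1 + α) * (k + 1)) *
        p * (p + 1) * (p + 2))
    (j : ℕ) :
    (t + 1) * X / ((p + 1) * (p + 2)) * dualHahn α β M j ((t + 1) * (t + 1 + s + 1) + s)
        - Y / (p * (p + 2)) * dualHahn α β M j (t * (t + s + 1) + s)
        + (t + s) * Z / (p * (p + 1)) * dualHahn α β M j ((t - 1) * (t - 1 + s + 1) + s) =
      (η * j + κ) * dualHahn α β M j (t * (t + s + 1) + s) := by
  simp only [mul_div_assoc]
  refine dualHahn_difference hα β hs ?_ (fun k => ?_) j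
  · linear_combination three_term_div_eq hp₀ hp₁ hp₂ h₀
  · linear_combination three_term_div_eq hp₀ hp₁ hp₂ (h₁ k)

/-- Lemma 5.1: the dual Hahn polynomials `Z_j^h` satisfy the lowering recurrence
built from the three-term recurrence coefficients of the Hahn polynomials. -/
theorem dualHahn_recurrence (a b N : ℝ)
    (h : Fin 4) (j : ℕ) (n : ℤ)
    (hb : h = 0 ∨ h = 2 → ∀ k : ℕ, b ≠ (k : ℝ) + 1)
    (ha : h = 1 ∨ h = 3 → ∀ k : ℕ, a ≠ (k : ℝ) + 1)
    (hden1 : epsFourDenom a b N h (n : ℝ))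
    (hden2 : epsFourDenom a b N h ((n : ℝ) + 1))
    (hden3 : 2 * (n : ℝ) + a + b ≠ 0)
    (hden4 : 2 * (n : ℝ) + a + b + 1 ≠ 0)
    (hden5 : 2 * (n : ℝ) + a + b + 2 ≠ 0)
    (hεne : epsFour a b N h (n : ℝ) ≠ 0) :
    epsFour a b N h ((n : ℝ) + 1) *
        (-((((n : ℝ) + 1) * (((n : ℝ) + 1) + a) * (((n : ℝ) + 1) + a + b + N + 1)) /
            ((2 * ((n : ℝ) + 1) + a + b - 1) * (2 * ((n : ℝ) + 1) + a + b)))) *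
        Zdual a b N h j (((n : ℝ) + 1) * (((n : ℝ) + 1) + a + b + 1))
      - ((N * (a + 1) * (a + b) + (n : ℝ) * (2 * N + b - a) * ((n : ℝ) + a + b + 1)) /
          ((2 * (n : ℝ) + a + b) * (2 * (n : ℝ) + a + b + 2))) *
        Zdual a b N h j ((n : ℝ) * ((n : ℝ) + a + b + 1))
      + ((-((((n : ℝ) + a + b) * ((n : ℝ) + b) * (N - (n : ℝ) + 1)) /
            ((2 * (n : ℝ) + a + b) * (2 * (n : ℝ) + a + b + 1)))) /
          epsFour a b N h (n : ℝ)) *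
        Zdual a b N h j (((n : ℝ) - 1) * (((n : ℝ) - 1) + a + b + 1))
      = (etaFour h * (j : ℝ) + kappaFour a b N h) *
          Zdual a b N h j ((n : ℝ) * ((n : ℝ) + a + b + 1)) := by
  generalize (n : ℝ) = t at *
  have e₀ : t * (t + a + b + 1) + a + b = t * (t + (a + b) + 1) + (a + b) := by ring
  have e₁ : (t + 1) * (t + 1 + a + b + 1) + a + b =
      (t + 1) * (t + 1 + (a + b) + 1) + (a + b) := by ring
  have e₂ : (t - 1) * (t - 1 + a + b + 1) + a + b =
      (t - 1) * (t - 1 + (a + b) + 1) + (a + b) := by ring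
  have d₁ : 2 * (t + 1) + a + b - 1 = 2 * t + a + b + 1 := by ring
  have d₂ : 2 * (t + 1) + a + b = 2 * t + a + b + 2 := by ring
  rw [d₁, d₂]
  fin_cases h
  · have hα : ∀ k : ℕ, -b + 1 + (k : ℝ) ≠ 0 := fun k hk =>
      hb (by simp) k (by linarith)
    simp only [epsFour, epsFourDenom, Zdual, etaFour, kappaFour, Fin.isValue,
      Fin.reduceEq, Fin.zero_eta, if_true, if_false] at hden1 hden2 hεne ⊢
    rw [e₀, e₁, e₂]
    have hN : t - N - 1 ≠ 0 := fun h0 => hεne (by simp [h0])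
    convert dualHahn_difference_div (α := -b) (s := a + b) (M := a + b + N) (t := t)
      (X := (t - N) * (t + 1 + a))
      (Y := N * (a + 1) * (a + b) + t * (2 * N + b - a) * (t + a + b + 1))
      (Z := -((t + b) * (t + a + b + N + 1)))
      (η := 1) (κ := -b - N) hα (-a) (by ring) hden3 hden4 hden5 (by ring)
      (fun k => by ring) j using 3
    · congr 1
      field_simp
      ring
    · field_simp
      ring
  · have hα : ∀ k : ℕ, -a + 1 + (k : ℝ) ≠ 0 := fun k hk =>
      ha (by simp) k (by linarith)
    simp only [epsFour, epsFourDenom, Zdual, etaFour, kappaFour, Fin.isValue,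
      Fin.reduceEq, Fin.mk_one, if_true, if_false] at hden1 hden2 hεne ⊢
    rw [e₀, e₁, e₂]
    have hN : t - N - 1 ≠ 0 := fun h0 => hεne (by simp [h0])
    have htb : t + b ≠ 0 := fun h0 => hεne (by simp [h0])
    obtain ⟨hta₀, hden1⟩ := hden1
    obtain ⟨hta₁, hden2⟩ := hden2
    convert dualHahn_difference_div (α := -a) (s := a + b) (M := a + b + N) (t := t)
      (X := -((t - N) * (t + 1 + b)))
      (Y := N * (a + 1) * (a + b) + t * (2 * N + b - a) * (t + a + b + 1))
      (Z := (t + a) * (t + a + b + N + 1))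
      (η := -1) (κ := a) hα (-b) (by ring) hden3 hden4 hden5 (by ring)
      (fun k => by ring) j using 3
    · congr 1
      field_simp
      ring
    · field_simp
      ring
  · have hα : ∀ k : ℕ, -b + 1 + (k : ℝ) ≠ 0 := fun k hk =>
      hb (by simp) k (by linarith)
    simp only [epsFour, epsFourDenom, Zdual, etaFour, kappaFour, Fin.reduceFinMk, Fin.isValue,
      Fin.reduceEq, if_true, if_false] at hden1 hden2 hεne ⊢
    rw [e₀, e₁, e₂]
    convert dualHahn_difference_div (α := -b) (s := a + b) (M := -2 - N) (t := t)
      (X := -((t + 1 + a) * (t + a + b + N + 2)))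
      (Y := N * (a + 1) * (a + b) + t * (2 * N + b - a) * (t + a + b + 1))
      (Z := -((t + b) * (N - t + 1)))
      (η := -1) (κ := -N - 1) hα (-a) (by ring) hden3 hden4 hden5 (by ring)
      (fun k => by ring) j using 3
    · congr 1
      field_simp
      ring
    · field_simp
      ring
  · have hα : ∀ k : ℕ, -a + 1 + (k : ℝ) ≠ 0 := fun k hk =>
      ha (by simp) k (by linarith)
    simp only [epsFour, epsFourDenom, Zdual, etaFour, kappaFour, Fin.reduceFinMk, Fin.isValue,
      Fin.reduceEq, if_false] at hden1 hden2 hεne ⊢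
    rw [e₀, e₁, e₂]
    have htb : t + b ≠ 0 := fun h0 => hεne (by simp [h0])
    convert dualHahn_difference_div (α := -a) (s := a + b) (M := -2 - N) (t := t)
      (X := (t + 1 + b) * (t + a + b + N + 2))
      (Y := N * (a + 1) * (a + b) + t * (2 * N + b - a) * (t + a + b + 1))
      (Z := (t + a) * (N - t + 1))
      (η := 1) (κ := 1) hα (-b) (by ring) hden3 hden4 hden5 (by ring)
      (fun k => by ring) j using 3
    · congr 1
      field_simp
      ring
    · field_simp
      ring
end
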